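/- If a surface S has a boundary isolating curve, then S is not properly homotopy equivalent to any graph. -/

import Mathlib

open Set Topology unitInterval

noncomputable section

/-- A map is proper-continuous: continuous and the preimage of every compact set is compact. -/
def ProperCont {X Y : Type*} [TopologicalSpace X] [TopologicalSpace Y] (f : X → Y) : Prop :=
  Continuous f ∧ ∀ K : Set Y, IsCompact K → IsCompact (f ⁻¹' K)

/-- `f` and `g` are homotopic. -/
def Htpc {X Y : Type*} [TopologicalSpace X] [TopologicalSpace Y] (f g : X → Y) : Prop :=
  ∃ H : X × I → Y, Continuous H ∧ (∀ x, H (x, 0) = f x) ∧ (∀ x, H (x, 1) = g x)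

/-- `f` and `g` are properly homotopic: joined by a homotopy which is itself a proper map. -/
def PHtpc {X Y : Type*} [TopologicalSpace X] [TopologicalSpace Y] (f g : X → Y) : Prop :=
  ∃ H : X × I → Y, ProperCont H ∧ (∀ x, H (x, 0) = f x) ∧ (∀ x, H (x, 1) = g x)

/-- `φ` is a proper homotopy equivalence with proper homotopy inverse `ψ`. -/
def IsPHEPair {X Y : Type*} [TopologicalSpace X] [TopologicalSpace Y]
    (φ : X → Y) (ψ : Y → X) : Prop :=
  ProperCont φ ∧ ProperCont ψ ∧ PHtpc (ψ ∘ φ) id ∧ PHtpc (φ ∘ ψ) id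

/-- `φ` is a proper homotopy equivalence (admitting some proper homotopy inverse). -/
def IsPHE {X Y : Type*} [TopologicalSpace X] [TopologicalSpace Y] (φ : X → Y) : Prop :=
  ∃ ψ : Y → X, IsPHEPair φ ψ

/-- `X` and `Y` are properly homotopy equivalent. -/
def PHEquivalent (X Y : Type*) [TopologicalSpace X] [TopologicalSpace Y] : Prop :=
  ∃ φ : X → Y, IsPHE φ

/-- The standard Möbius band, realized as a subset of `ℝ³`. -/
def MobiusBand : Set (ℝ × ℝ × ℝ) :=
  {p | ∃ u v : ℝ, |v| ≤ 1 / 2 ∧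
    p = ((1 + v * Real.cos (u / 2)) * Real.cos u,
         (1 + v * Real.cos (u / 2)) * Real.sin u,
         v * Real.sin (u / 2))}

/-- A surface: a connected, orientable (no embedded Möbius band), second-countable, Hausdorff
topological 2-manifold, possibly with boundary (locally modeled on the closed half-plane). -/
structure IsSurface (S : Type*) [TopologicalSpace S] : Prop where
  connected : ConnectedSpace S
  t2 : T2Space S
  secondCountable : SecondCountableTopology S
  locallyHalfPlane : ∀ x : S, ∃ (U : Set S) (V : Set {p : ℝ × ℝ // 0 ≤ p.2}),
    IsOpen U ∧ x ∈ U ∧ IsOpen V ∧ Nonempty (↥U ≃ₜ ↥V)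
  orientable : ¬ ∃ f : ↥MobiusBand → S, IsEmbedding f

/-- The boundary of a surface: the set of points having no open neighborhood
homeomorphic to `ℝ²`. -/
def Bd (S : Type*) [TopologicalSpace S] : Set S :=
  {x | ¬ ∃ U : Set S, IsOpen U ∧ x ∈ U ∧ Nonempty (↥U ≃ₜ (ℝ × ℝ))}

/-- The unit circle in the plane. -/
def Circ : Set (ℝ × ℝ) := {p | p.1 ^ 2 + p.2 ^ 2 = 1}

/-- A simple closed curve in `S`: the image of a topological embedding of the circle. -/
def IsSimpleClosedCurve {S : Type*} [TopologicalSpace S] (α : Set S) : Prop :=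
  ∃ f : ↥Circ → S, IsEmbedding f ∧ range f = α

/-- A boundary isolating curve: a simple closed curve `α ⊆ S ∖ ∂S` such that `S ∖ α` has
exactly two connected components `Y` and `Z` with `Y ∩ ∂S ≠ ∅`, `Z ∩ ∂S = ∅`, and
`Z ∪ α` noncompact. -/
def IsBoundaryIsolating {S : Type*} [TopologicalSpace S] (α : Set S) : Prop :=
  IsSimpleClosedCurve α ∧ α ∩ Bd S = ∅ ∧
  ∃ Y Z : Set S, Y ≠ Z ∧
    (∀ C : Set S, (∃ x ∈ αᶜ, C = connectedComponentIn αᶜ x) ↔ (C = Y ∨ C = Z)) ∧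
    (Y ∩ Bd S).Nonempty ∧ Z ∩ Bd S = ∅ ∧ ¬ IsCompact (Z ∪ α)

/-- The open part of the parametrizing interval of an edge. -/
def edgeInt : Set I := {t : I | 0 < (t : ℝ) ∧ (t : ℝ) < 1}

/-- A graph: a connected, locally finite, Hausdorff, 1-dimensional CW complex, presented by a
closed discrete vertex set and a set of characteristic maps of edges. -/
structure IsGraph (Γ : Type*) [TopologicalSpace Γ] : Prop where
  connected : ConnectedSpace Γ
  t2 : T2Space Γ
  cell_structure : ∃ (V : Set Γ) (E : Set C(I, Γ)),
    IsClosed V ∧ DiscreteTopology ↥V ∧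
    (∀ e ∈ E, e 0 ∈ V ∧ e 1 ∈ V) ∧
    (∀ e ∈ E, IsEmbedding (fun t : ↥edgeInt => e t.1)) ∧
    (∀ e ∈ E, (⇑e '' edgeInt) ∩ V = ∅) ∧
    (∀ e ∈ E, ∀ e' ∈ E, e ≠ e' → (⇑e '' edgeInt) ∩ (⇑e' '' edgeInt) = ∅) ∧
    (V ∪ ⋃ e ∈ E, ⇑e '' edgeInt) = univ ∧
    (∀ x : Γ, ∃ U : Set Γ, IsOpen U ∧ x ∈ U ∧ {e ∈ E | (range ⇑e ∩ U).Nonempty}.Finite) ∧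
    (∀ A : Set Γ, (∀ e ∈ E, IsClosed (⇑e ⁻¹' A)) → IsClosed (A ∩ ⋃ e ∈ E, range ⇑e)) ∧
    (∀ v ∈ V, (∃ e ∈ E, v ∈ range ⇑e) ∨ (univ : Set Γ) = {v})

/-- A finite graph: a graph with finitely many cells, equivalently a compact graph. -/
def IsFiniteGraph (Γ : Type*) [TopologicalSpace Γ] : Prop :=
  IsGraph Γ ∧ CompactSpace Γ

/-- A deformation retraction of `S` onto the subspace `A`. -/
def IsDeformationRetraction {S : Type*} [TopologicalSpace S] (H : S × I → S) (A : Set S) :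
    Prop :=
  Continuous H ∧ (∀ x, H (x, 0) = x) ∧ (∀ x, H (x, 1) ∈ A) ∧ (∀ a ∈ A, H (a, 1) = a)

/-- A proper deformation retraction of `S` onto the subspace `A`. -/
def IsProperDeformationRetraction {S : Type*} [TopologicalSpace S] (H : S × I → S)
    (A : Set S) : Prop :=
  ProperCont H ∧ (∀ x, H (x, 0) = x) ∧ (∀ x, H (x, 1) ∈ A) ∧ (∀ a ∈ A, H (a, 1) = a)

/-- An end of a space, recorded as a compatible choice of a connected component of the
complement of each compact set. -/
def IsEndFn {Γ : Type*} [TopologicalSpace Γ] (s : Set Γ → Set Γ) : Prop :=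
  (∀ K : Set Γ, IsCompact K → ∃ x ∈ Kᶜ, s K = connectedComponentIn Kᶜ x) ∧
  (∀ K K' : Set Γ, IsCompact K → IsCompact K' → K ⊆ K' → s K' ⊆ s K)

/-- A proper map induces the identity on the space of ends. -/
def InducesIdOnEnds {Γ : Type*} [TopologicalSpace Γ] (g : Γ → Γ) : Prop :=
  ∀ s : Set Γ → Set Γ, IsEndFn s → ∀ K : Set Γ, IsCompact K →
    ∃ K' : Set Γ, IsCompact K' ∧ K ⊆ K' ∧ g '' s K' ⊆ s K

/-- An isotopy between `f` and `g` relative to the set `B`: a homotopy each of whose time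
slices is a homeomorphism fixing `B` pointwise. -/
def IsotopicRel {S : Type*} [TopologicalSpace S] (B : Set S) (f g : S → S) : Prop :=
  ∃ H : S × I → S, Continuous H ∧ (∀ x, H (x, 0) = f x) ∧ (∀ x, H (x, 1) = g x) ∧
    ∀ t : I, IsHomeomorph (fun x => H (x, t)) ∧ ∀ x ∈ B, H (x, t) = x

/-- An isotopy between `f` and `g`: a homotopy each of whose time slices is a
homeomorphism. -/
def Isotopic {S : Type*} [TopologicalSpace S] (f g : S → S) : Prop :=
  ∃ H : S × I → S, Continuous H ∧ (∀ x, H (x, 0) = f x) ∧ (∀ x, H (x, 1) = g x) ∧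
    ∀ t : I, IsHomeomorph (fun x => H (x, t))

/-- Representatives for the mapping class group of a surface: homeomorphisms fixing the
boundary pointwise, with the compact-open topology. -/
abbrev MCGRep (S : Type*) [TopologicalSpace S] :=
  {f : C(S, S) // IsHomeomorph ⇑f ∧ ∀ x ∈ Bd S, f x = x}

/-- The isotopy-rel-boundary relation on representatives. -/
def mcgRel (S : Type*) [TopologicalSpace S] (f g : MCGRep S) : Prop :=
  IsotopicRel (Bd S) ⇑f.1 ⇑g.1

/-- The mapping class group `Map(S)` of a surface as a topological space: homeomorphisms
fixing the boundary pointwise, modulo isotopy rel boundary, with the quotient of the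
compact-open topology. -/
abbrev MCG (S : Type*) [TopologicalSpace S] := Quot (mcgRel S)

/-- Representatives for the extended mapping class group: all homeomorphisms. -/
abbrev ExRep (S : Type*) [TopologicalSpace S] := {f : C(S, S) // IsHomeomorph ⇑f}

/-- The (free) isotopy relation on representatives. -/
def exRel (S : Type*) [TopologicalSpace S] (f g : ExRep S) : Prop :=
  Isotopic ⇑f.1 ⇑g.1

/-- The extended mapping class group `ExMap(S)` as a topological space. -/
abbrev ExMCG (S : Type*) [TopologicalSpace S] := Quot (exRel S)

/-- Representatives for the mapping class group of a graph: proper homotopy equivalences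
admitting a proper homotopy inverse, with the compact-open topology. -/
abbrev GphRep (Γ : Type*) [TopologicalSpace Γ] := {g : C(Γ, Γ) // IsPHE ⇑g}

/-- The proper homotopy relation on representatives. -/
def gphRel (Γ : Type*) [TopologicalSpace Γ] (g h : GphRep Γ) : Prop :=
  PHtpc ⇑g.1 ⇑h.1

/-- The mapping class group `Map(Γ)` of a graph as a topological space. -/
abbrev GphMCG (Γ : Type*) [TopologicalSpace Γ] := Quot (gphRel Γ)

/-- Rotation of the unit circle by angle `a`. -/
def rotC (a : ℝ) (p : ↥Circ) : ↥Circ :=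
  ⟨(p.1.1 * Real.cos a - p.1.2 * Real.sin a, p.1.1 * Real.sin a + p.1.2 * Real.cos a), by
    have h : p.1.1 ^ 2 + p.1.2 ^ 2 = 1 := p.2
    have h2 := Real.sin_sq_add_cos_sq a
    simp only [Circ, Set.mem_setOf_eq]
    nlinarith [h, h2]⟩

/-- Reflection of the unit circle (the standard orientation-reversing involution). -/
def circConj (p : ↥Circ) : ↥Circ :=
  ⟨(p.1.1, -p.1.2), by
    have h : p.1.1 ^ 2 + p.1.2 ^ 2 = 1 := p.2
    simp only [Circ, Set.mem_setOf_eq]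
    nlinarith [h]⟩

/-- The midpoint of the unit interval. -/
def ihalf : I := ⟨1 / 2, by norm_num [Set.mem_Icc]⟩

/-- `f` is the twist map determined by an embedded annular collar `e`:
`e(θ,t) ↦ e(θ + 2πt, t)` on the image of `e` and the identity elsewhere. -/
def IsTwistMap {S : Type*} [TopologicalSpace S] (e : ↥Circ × I → S) (f : S → S) : Prop :=
  IsEmbedding e ∧
  (∀ (θ : ↥Circ) (t : I), f (e (θ, t)) = e (rotC (2 * Real.pi * (t : ℝ)) θ, t)) ∧
  (∀ x, x ∉ range e → f x = x)

/-- A Dehn twist about a compact boundary component of `S`. -/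
def IsCptBdTwist {S : Type*} [TopologicalSpace S] (f : S → S) : Prop :=
  ∃ e : ↥Circ × I → S, IsTwistMap e f ∧
    (∃ x ∈ Bd S, range (fun θ : ↥Circ => e (θ, 0)) = connectedComponentIn (Bd S) x ∧
      IsCompact (connectedComponentIn (Bd S) x)) ∧
    (∀ (θ : ↥Circ) (t : I), (t : ℝ) ≠ 0 → e (θ, t) ∉ Bd S)

/-- The closed unit disk in the plane. -/
def ClosedDisk : Set (ℝ × ℝ) := {p | p.1 ^ 2 + p.2 ^ 2 ≤ 1}

/-- A Dehn twist about a degenerate boundary chain: a twist supported in an annulus disjoint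
from `∂S` whose core curve cuts off a piece homeomorphic to a closed disk with a nonempty
proper closed subset removed from its boundary circle. -/
def IsDegChainTwist {S : Type*} [TopologicalSpace S] (f : S → S) : Prop :=
  ∃ e : ↥Circ × I → S, IsTwistMap e f ∧ range e ∩ Bd S = ∅ ∧
    ∃ x ∈ (range fun θ : ↥Circ => e (θ, ihalf))ᶜ,
      ∃ J : Set (ℝ × ℝ), J ⊆ Circ ∧ IsClosed J ∧ J.Nonempty ∧ J ≠ Circ ∧
        Nonempty
          (↥(closure (connectedComponentIn (range fun θ : ↥Circ => e (θ, ihalf))ᶜ x)) ≃ₜ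
            ↥(ClosedDisk \ J))

/-- `f` is a finite composition of maps satisfying the predicate `P`. -/
def IsProductOf {S : Type*} [TopologicalSpace S] (P : (S → S) → Prop) (f : S → S) : Prop :=
  ∃ L : List (S → S), (∀ g ∈ L, P g) ∧ f = L.foldr (· ∘ ·) id

/-- The closed half-strip `[0,∞) × [0,1]`. -/
def HalfStrip : Set (ℝ × ℝ) := {p | 0 ≤ p.1 ∧ 0 ≤ p.2 ∧ p.2 ≤ 1}

/-- The closed strip `ℝ × [0,1]`. -/
def FullStrip : Set (ℝ × ℝ) := {p | 0 ≤ p.2 ∧ p.2 ≤ 1}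

/-- A closed annulus in the plane. -/
def AnnulusSet : Set (ℝ × ℝ) := {p | 1 ≤ p.1 ^ 2 + p.2 ^ 2 ∧ p.1 ^ 2 + p.2 ^ 2 ≤ 4}

/-- A surface is sporadic if it is homeomorphic to the closed disk, the half-strip, the
strip, or the annulus. -/
def IsSporadic (S : Type*) [TopologicalSpace S] : Prop :=
  Nonempty (S ≃ₜ ↥ClosedDisk) ∨ Nonempty (S ≃ₜ ↥HalfStrip) ∨
    Nonempty (S ≃ₜ ↥FullStrip) ∨ Nonempty (S ≃ₜ ↥AnnulusSet)

/-- A parametrization of a compact boundary component of `S` by the circle. -/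
def IsCptBdParam {S : Type*} [TopologicalSpace S] (β : ↥Circ → S) : Prop :=
  IsEmbedding β ∧ ∃ x ∈ Bd S, range β = connectedComponentIn (Bd S) x ∧
    IsCompact (range β)

/-- A proper parametrization of a noncompact boundary component of `S` by the line. -/
def IsNcptBdParam {S : Type*} [TopologicalSpace S] (β : ℝ → S) : Prop :=
  IsEmbedding β ∧ ProperCont β ∧ ∃ x ∈ Bd S, range β = connectedComponentIn (Bd S) x ∧
    ¬ IsCompact (range β)

/-- `g` fixes (up to homotopy, resp. proper homotopy, and preserving orientations) each
curve and line of the collection `B` of `φ'`-images of boundary components: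
membership in `Map(Γ, B)`. -/
def FixesBdryImages {S : Type*} [TopologicalSpace S] (G : Set S) (φ' : S → ↥G)
    (g : ↥G → ↥G) : Prop :=
  (∀ β : ↥Circ → S, IsCptBdParam β → Htpc (g ∘ φ' ∘ β) (φ' ∘ β)) ∧
  (∀ β : ℝ → S, IsNcptBdParam β → PHtpc (g ∘ φ' ∘ β) (φ' ∘ β))

/-- `g` preserves the collection `B` of `φ'`-images of boundary components, possibly
permuting its members and reversing orientations: membership in `Map*(Γ, B)`. -/
def PermutesBdryImages {S : Type*} [TopologicalSpace S] (G : Set S) (φ' : S → ↥G)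
    (g : ↥G → ↥G) : Prop :=
  (∀ β : ↥Circ → S, IsCptBdParam β → ∃ β' : ↥Circ → S, IsCptBdParam β' ∧
    (Htpc (g ∘ φ' ∘ β) (φ' ∘ β') ∨ Htpc (g ∘ φ' ∘ β) (φ' ∘ β' ∘ circConj))) ∧
  (∀ β : ℝ → S, IsNcptBdParam β → ∃ β' : ℝ → S, IsNcptBdParam β' ∧
    (PHtpc (g ∘ φ' ∘ β) (φ' ∘ β') ∨ PHtpc (g ∘ φ' ∘ β) (φ' ∘ β' ∘ (fun r : ℝ => -r))))

end

/-- A continuous family of paths of nonzero complex numbers has a continuous logarithm of the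
quotient of its endpoints. -/
theorem exists_exp_eq_of_homotopy {X : Type*} [TopologicalSpace X] {H : I × X → ℂ}
    (hH : Continuous H) (h0 : ∀ p, H p ≠ 0) :
    ∃ θ : X → ℂ, Continuous θ ∧ ∀ x, H (1, x) = H (0, x) * Complex.exp (θ x) := by
  let K : C(I × X, {z : ℂ // z ≠ 0}) :=
    ⟨fun p => ⟨H p / H (0, p.2), div_ne_zero (h0 _) (h0 _)⟩, by
      refine Continuous.subtype_mk (hH.div₀ (hH.comp (by fun_prop)) fun p => h0 _) _⟩
  let f : C(X, ℂ) := ⟨fun _ => 0, continuous_const⟩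
  have hK : ∀ a, K (0, a) = (⟨_, (f a).exp_ne_zero⟩ : {z : ℂ // z ≠ 0}) := by
    intro a
    apply Subtype.ext
    simp [K, f, h0]
  let L := Complex.isCoveringMap_exp.liftHomotopy K f hK
  refine ⟨fun x => L (1, x), by fun_prop, fun x => ?_⟩
  have := congrArg Subtype.val
    (congrFun (Complex.isCoveringMap_exp.liftHomotopy_lifts K f hK) (1, x))
  have h2 : Complex.exp (L (1, x)) = H (1, x) / H (0, x) := this
  rw [h2, mul_div_cancel₀ _ (h0 _)]

theorem exists_exp_eqOn_of_convex {C : Set ℂ} (hC : Convex ℝ C) {u : ℂ → ℂ}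
    (hu : ContinuousOn u C) (h0 : ∀ z ∈ C, u z ≠ 0) :
    ∃ L : ℂ → ℂ, ContinuousOn L C ∧ ∀ z ∈ C, u z = Complex.exp (L z) := by
  classical
  rcases C.eq_empty_or_nonempty with rfl | ⟨c, hc⟩
  · exact ⟨0, by simp, by simp⟩
  have hmem : ∀ p : I × C, c + (p.1 : ℝ) • ((p.2 : ℂ) - c) ∈ C := fun p =>
    hC.add_smul_sub_mem hc p.2.2 p.1.2
  have hc1 : Continuous fun p : I × C => u (c + (p.1 : ℝ) • ((p.2 : ℂ) - c)) :=
    hu.comp_continuous (by fun_prop) hmem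
  obtain ⟨θ, hθ, h⟩ := exists_exp_eq_of_homotopy hc1 fun p => h0 _ (hmem p)
  refine ⟨fun z => Complex.log (u c) + if hz : z ∈ C then θ ⟨z, hz⟩ else 0, ?_, fun z hz => ?_⟩
  · rw [continuousOn_iff_continuous_domRestrict]
    refine ((continuous_const (y := Complex.log (u c))).add hθ).congr fun z => ?_
    simp [Set.domRestrict]
  · have := h ⟨z, hz⟩
    simp only [Set.Icc.coe_one, one_smul, add_sub_cancel, Set.Icc.coe_zero, zero_smul,
      add_zero] at this
    simp [hz, Complex.exp_add, Complex.exp_log (h0 c hc), this]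

/-- A continuous function on a connected set with values in `2πiℤ` is constant. -/
theorem eqOn_of_exp_eq_one {C : Set ℂ} (hC : IsPreconnected C) {f : ℂ → ℂ}
    (hf : ContinuousOn f C) (h : ∀ z ∈ C, Complex.exp (f z) = 1) {a b : ℂ} (ha : a ∈ C)
    (hb : b ∈ C) : f a = f b := by
  have hcov := Complex.isCoveringMap_exp
  have : PreconnectedSpace C := isPreconnected_iff_preconnectedSpace.mp hC
  have h1 : Continuous fun z : C => f z := continuousOn_iff_continuous_domRestrict.mp hf
  have := hcov.eq_of_comp_eq (g₁ := fun z : C => f z)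
    (g₂ := fun z : C => f a) h1 continuous_const (by
      ext z
      simp [h z z.2, h a ha]) ⟨a, ha⟩ rfl
  exact (congrFun this ⟨b, hb⟩).symm

/-- Local structure of a continuous function near an isolated zero in the plane. -/
theorem exists_zpow_mul_exp_on_ball {u : ℂ → ℂ} {q : ℂ} {r : ℝ} (hr : 0 < r)
    (hu : ContinuousOn u (Metric.ball q r \ {q})) (h0 : ∀ z ∈ Metric.ball q r \ {q}, u z ≠ 0) :
    ∃ (n : ℤ) (L : ℂ → ℂ), ContinuousOn L (Metric.ball q r \ {q}) ∧
      ∀ z ∈ Metric.ball q r \ {q}, u z = (z - q) ^ n * Complex.exp (L z) := by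
  set D : Set ℂ := {w | w.re < Real.log r} with hD
  have hDo : IsOpen D := isOpen_lt Complex.continuous_re continuous_const
  have hDc : Convex ℝ D := convex_halfSpace_re_lt _
  have hmap : MapsTo (fun w => q + Complex.exp w) D (Metric.ball q r \ {q}) := by
    intro w hw
    refine ⟨?_, by simp⟩
    have : Real.exp w.re < r := by
      rw [← Real.exp_log hr]; exact Real.exp_lt_exp.mpr hw
    simpa [Complex.norm_exp] using this
  obtain ⟨M, hM, hMe⟩ := exists_exp_eqOn_of_convex hDc
    (hu.comp (f := fun w => q + Complex.exp w) (by fun_prop) hmap) fun w hw => h0 _ (hmap hw)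
  have hlog : ∀ z ∈ Metric.ball q r \ {q}, Complex.log (z - q) ∈ D := by
    rintro z ⟨hz, hzq⟩
    have hzq' : 0 < ‖z - q‖ := norm_pos_iff.mpr (sub_ne_zero.mpr hzq)
    simp only [hD, Set.mem_ofPred_eq, Complex.log_re]
    exact Real.log_lt_log hzq' (by simpa [dist_eq_norm] using hz)
  have hsh : ∀ w ∈ D, w + 2 * Real.pi * Complex.I ∈ D := by
    intro w hw
    simpa [hD] using hw
  have hper : ∀ w ∈ D, Complex.exp (M (w + 2 * Real.pi * Complex.I) - M w) = 1 := by
    intro w hw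
    have h1 := hMe _ (hsh w hw)
    have h2 := hMe _ hw
    simp only [Function.comp_apply, Complex.exp_periodic w] at h1 h2
    rw [Complex.exp_sub, ← h1, ← h2, div_self (h0 _ (hmap hw))]
  set w0 : ℂ := ((Real.log r - 1 : ℝ) : ℂ) with hw0
  have hw0D : w0 ∈ D := by simp [hD, hw0]
  obtain ⟨n, hn⟩ := Complex.exp_eq_one_iff.mp (hper w0 hw0D)
  have hconst : ∀ w ∈ D, M (w + 2 * Real.pi * Complex.I) - M w = n * (2 * Real.pi * Complex.I) := by
    intro w hw
    rw [← hn]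
    refine eqOn_of_exp_eq_one hDc.isPreconnected
      (f := fun w => M (w + 2 * Real.pi * Complex.I) - M w) ?_ hper hw hw0D
    exact (hM.comp (by fun_prop) hsh).sub hM
  classical
  set N : ℂ → ℂ := fun w => if w ∈ D then M w - n * w else 0 with hN
  have hNper : Function.Periodic N (2 * Real.pi * Complex.I) := by
    intro w
    by_cases hw : w ∈ D
    · simp only [hN, hw, hsh w hw, if_true]
      linear_combination hconst w hw
    · have : w + 2 * Real.pi * Complex.I ∉ D := by simpa [hD] using hw
      simp [hN, hw, this]
  have hNc : ∀ w ∈ D, ContinuousAt N w := by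
    intro w hw
    have : ContinuousAt (fun w => M w - n * w) w :=
      (hM.continuousAt (hDo.mem_nhds hw)).sub (by fun_prop)
    refine this.congr ?_
    filter_upwards [hDo.mem_nhds hw] with v hv
    simp [hN, hv]
  refine ⟨n, fun z => N (Complex.log (z - q)), ?_, ?_⟩
  · intro z0 hz0
    apply ContinuousAt.continuousWithinAt
    have hz0q : z0 - q ≠ 0 := sub_ne_zero.mpr hz0.2
    set l : ℂ → ℂ := fun z => Complex.log (z0 - q) + Complex.log ((z - q) / (z0 - q)) with hl
    have hl0 : l z0 = Complex.log (z0 - q) := by simp [hl, div_self hz0q]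
    have hlc : ContinuousAt l z0 := by
      refine continuousAt_const.add (ContinuousAt.clog (by fun_prop) ?_)
      simp [div_self hz0q]
    have hc : ContinuousAt (fun z => N (l z)) z0 := by
      refine ContinuousAt.comp' ?_ hlc
      rw [hl0]; exact hNc _ (hlog z0 hz0)
    refine hc.congr ?_
    have : ∀ᶠ z in 𝓝 z0, z ≠ q := isOpen_ne.mem_nhds hz0.2
    filter_upwards [this] with z hz
    have hzq : z - q ≠ 0 := sub_ne_zero.mpr hz
    have he : Complex.exp (l z) = Complex.exp (Complex.log (z - q)) := by
      rw [hl, Complex.exp_add, Complex.exp_log hz0q, Complex.exp_log (div_ne_zero hzq hz0q),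
        Complex.exp_log hzq, mul_div_cancel₀ _ hz0q]
    obtain ⟨k, hk⟩ := Complex.exp_eq_exp_iff_exists_int.mp he
    rw [hk]
    exact hNper.int_mul k _
  · intro z hz
    have hzq : z - q ≠ 0 := sub_ne_zero.mpr hz.2
    have h1 := hMe _ (hlog z hz)
    simp only [Function.comp_apply, Complex.exp_log hzq, add_sub_cancel] at h1
    simp only [hN, hlog z hz, if_true]
    rw [Complex.exp_sub, ← h1, Complex.exp_int_mul, Complex.exp_log hzq]
    field_simp

theorem eq_zero_of_zpow_eq_exp_on_sphere {L : ℂ → ℂ} {q : ℂ} {c : ℝ} (hc : 0 < c)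
    (hL : ContinuousOn L (Metric.sphere q c)) {N : ℤ}
    (h : ∀ z ∈ Metric.sphere q c, (z - q) ^ N = Complex.exp (L z)) : N = 0 := by
  set D : Set ℂ := {w | w.re = Real.log c} with hD
  have hDc : Convex ℝ D := convex_hyperplane (𝕜 := ℝ) Complex.reLm.isLinear _
  have hmap : MapsTo (fun w => q + Complex.exp w) D (Metric.sphere q c) := by
    intro w hw
    have : w.re = Real.log c := hw
    simp [Complex.norm_exp, this, Real.exp_log hc]
  have key := eqOn_of_exp_eq_one hDc.isPreconnected (f := fun w => N * w - L (q + Complex.exp w))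
    (ContinuousOn.sub (by fun_prop) (hL.comp (by fun_prop) hmap)) (fun w hw => by
      have := h _ (hmap hw)
      simp only [add_sub_cancel_left] at this
      rw [Complex.exp_sub, ← this, Complex.exp_int_mul, div_self]
      exact zpow_ne_zero _ (Complex.exp_ne_zero _))
    (a := (Real.log c : ℂ)) (b := Real.log c + 2 * Real.pi * Complex.I) (by simp [hD])
    (by simp [hD])
  simp only [Complex.exp_periodic (Real.log c : ℂ)] at key
  have h2 : (N : ℂ) * (2 * Real.pi * Complex.I) = 0 := by linear_combination -key
  have h3 : (2 * Real.pi * Complex.I : ℂ) ≠ 0 := Complex.two_pi_I_ne_zero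
  exact_mod_cast (mul_eq_zero.mp h2).resolve_right h3

set_option maxHeartbeats 1000000 in
/-- Global structure of a continuous function on the plane with finitely many zeros. -/
theorem exists_prod_zpow_mul_exp (Q : Finset ℂ) : ∀ u : ℂ → ℂ,
    ContinuousOn u (Q : Set ℂ)ᶜ → (∀ z ∉ Q, u z ≠ 0) →
    ∃ (n : ℂ → ℤ) (L : ℂ → ℂ), ContinuousOn L (Q : Set ℂ)ᶜ ∧
      ∀ z ∉ Q, u z = (∏ q ∈ Q, (z - q) ^ n q) * Complex.exp (L z) := by
  classical
  induction Q using Finset.induction_on with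
  | empty =>
    intro u hu h0
    obtain ⟨L, hL, h⟩ := exists_exp_eqOn_of_convex (C := univ) convex_univ (u := u)
      (by simpa using hu) fun z _ => h0 z (by simp)
    exact ⟨0, L, by simpa using hL, fun z _ => by simpa using h z trivial⟩
  | insert q Q hq ih =>
    intro u hu h0
    obtain ⟨r, hr, hrQ⟩ : ∃ r > 0, Metric.ball q r ⊆ (Q : Set ℂ)ᶜ :=
      Metric.isOpen_iff.mp Q.finite_toSet.isClosed.isOpen_compl q (by simpa using hq)
    have hsub : Metric.ball q r \ {q} ⊆ ((insert q Q : Finset ℂ) : Set ℂ)ᶜ := by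
      rintro z ⟨hz, hzq⟩
      have := hrQ hz
      simp_all
    obtain ⟨n0, L0, hL0, hu0⟩ := exists_zpow_mul_exp_on_ball hr (hu.mono hsub)
      fun z hz => h0 z (by simpa using hsub hz)
    set χ : ℂ → ℝ := fun z => max 0 (min 1 (2 - 4 * ‖z - q‖ / r)) with hχ
    have hχc : Continuous χ := by fun_prop
    set g : ℂ → ℂ := fun z => χ z * L0 z with hg
    have hgc : ∀ z ≠ q, ContinuousAt g z := by
      intro z hz
      by_cases hzr : z ∈ Metric.ball q r
      · have : IsOpen (Metric.ball q r \ {q}) := Metric.isOpen_ball.sdiff isClosed_singleton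
        have h1 := hL0.continuousAt (this.mem_nhds ⟨hzr, hz⟩)
        exact (Complex.continuous_ofReal.comp hχc).continuousAt.mul h1
      · have h1 : r / 2 < ‖z - q‖ := by
          simp only [Metric.mem_ball, dist_eq_norm, not_lt] at hzr
          linarith
        have h2 : ∀ᶠ y in 𝓝 z, r / 2 < ‖y - q‖ :=
          (isOpen_lt continuous_const (by fun_prop)).mem_nhds h1
        refine (continuousAt_const (y := (0 : ℂ))).congr ?_
        filter_upwards [h2] with y hy
        have : χ y = 0 := by
          refine max_eq_left ((min_le_right _ _).trans ?_)
          have : 2 < 4 * ‖y - q‖ / r := by rw [lt_div_iff₀ hr]; linarith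
          linarith
        simp [hg, this]
    have hu'c : ContinuousOn
        (fun z => if z = q then 1 else u z * (z - q) ^ (-n0) * Complex.exp (-g z))
        (Q : Set ℂ)ᶜ := by
      intro z hz
      apply ContinuousAt.continuousWithinAt
      by_cases hzq : z = q
      · subst hzq
        refine (continuousAt_const (y := (1 : ℂ))).congr ?_
        filter_upwards [Metric.ball_mem_nhds z (by positivity : (0 : ℝ) < r / 4)] with y hy
        by_cases hyz : y = z
        · simp [hyz]
        · have hy' : ‖y - z‖ < r / 4 := by simpa [dist_eq_norm] using hy
          have h1 : χ y = 1 := by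
            have : 4 * ‖y - z‖ / r ≤ 1 := by rw [div_le_iff₀ hr]; linarith
            simp only [hχ]
            rw [min_eq_left (by linarith)]; simp
          have h2 := hu0 y ⟨by simp [dist_eq_norm]; linarith, hyz⟩
          have h3 : (y - z) ^ n0 ≠ 0 := zpow_ne_zero _ (sub_ne_zero.mpr hyz)
          simp only [hyz, if_false, hg, h1, h2, Complex.exp_neg, zpow_neg]
          field_simp
          simp
      · have h1 : z ∈ ((insert q Q : Finset ℂ) : Set ℂ)ᶜ := by simp_all
        have h2 : ContinuousAt u z :=
          hu.continuousAt ((Finset.finite_toSet _).isClosed.isOpen_compl.mem_nhds h1)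
        have h4 : ContinuousAt (fun z => (z - q) ^ (-n0)) z :=
          ContinuousAt.zpow₀ (by fun_prop) _ (Or.inl (sub_ne_zero.mpr hzq))
        have h3 : ContinuousAt (fun z => u z * (z - q) ^ (-n0) * Complex.exp (-g z)) z :=
          (h2.mul h4).mul (hgc z hzq).neg.cexp
        refine h3.congr ?_
        filter_upwards [isOpen_ne.mem_nhds hzq] with y hy
        simp only [ne_eq] at hy
        simp [hy]
    obtain ⟨n, L, hL, h⟩ := ih _ hu'c (by
      intro z hz
      by_cases hzq : z = q
      · simp [hzq]
      · simp only [hzq, if_false]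
        exact mul_ne_zero (mul_ne_zero (h0 z (by simp [hz, hzq]))
          (zpow_ne_zero _ (sub_ne_zero.mpr hzq))) (Complex.exp_ne_zero _))
    refine ⟨Function.update n q n0, fun z => L z + g z, ?_, ?_⟩
    · intro z hz
      have hz' : z ≠ q ∧ z ∉ Q := by simpa using hz
      exact (ContinuousWithinAt.mono (hL z (by simpa using hz'.2))
        (by simp)).add (hgc z hz'.1).continuousWithinAt
    · intro z hz
      have hz' : z ≠ q ∧ z ∉ Q := by simpa using hz
      have h1 := h z hz'.2
      simp only [hz'.1, if_false] at h1
      have h3 : (z - q) ^ n0 ≠ 0 := zpow_ne_zero _ (sub_ne_zero.mpr hz'.1)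
      rw [Finset.prod_insert hq, Function.update_self, Complex.exp_add]
      have h4 : ∏ x ∈ Q, (z - x) ^ Function.update n q n0 x = ∏ x ∈ Q, (z - x) ^ n x := by
        refine Finset.prod_congr rfl fun x hx => ?_
        rw [Function.update_of_ne (by rintro rfl; exact hq hx)]
      rw [h4]
      have h5 : u z = (z - q) ^ n0 * Complex.exp (g z) *
          (u z * (z - q) ^ (-n0) * Complex.exp (-g z)) := by
        rw [Complex.exp_neg, zpow_neg]
        field_simp
      rw [h5, h1]
      ring

/-- A complex function has even order at `x` if it has a continuous square root on a punctured
neighbourhood of `x`. -/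
def IsEvenAt {X : Type*} [TopologicalSpace X] (u : X → ℂ) (x : X) : Prop :=
  ∃ s : X → ℂ, ∀ᶠ y in 𝓝[≠] x, ContinuousAt s y ∧ s y ^ 2 = u y

namespace IsEvenAt

variable {X Y : Type*} [TopologicalSpace X] [TopologicalSpace Y] {u v : X → ℂ} {x : X}

theorem congr (hu : IsEvenAt u x) (h : ∀ᶠ y in 𝓝[≠] x, u y = v y) : IsEvenAt v x := by
  obtain ⟨s, hs⟩ := hu
  refine ⟨s, ?_⟩
  filter_upwards [hs, h] with y h1 h2
  exact ⟨h1.1, h1.2.trans h2⟩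

theorem mul (hu : IsEvenAt u x) (hv : IsEvenAt v x) : IsEvenAt (fun y => u y * v y) x := by
  obtain ⟨s, hs⟩ := hu
  obtain ⟨t, ht⟩ := hv
  refine ⟨fun y => s y * t y, ?_⟩
  filter_upwards [hs, ht] with y h1 h2
  exact ⟨h1.1.mul h2.1, by rw [mul_pow, h1.2, h2.2]⟩

theorem conj (hu : IsEvenAt u x) : IsEvenAt (fun y => star (u y)) x := by
  obtain ⟨s, hs⟩ := hu
  refine ⟨fun y => star (s y), ?_⟩
  filter_upwards [hs] with y h1
  exact ⟨h1.1.star, by rw [← h1.2, star_pow]⟩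

theorem conj_iff : IsEvenAt (fun y => star (u y)) x ↔ IsEvenAt u x :=
  ⟨fun h => by simpa using h.conj, conj⟩

theorem of_mul_left (h : IsEvenAt (fun y => u y * v y) x) (hu : IsEvenAt u x)
    (h0 : ∀ᶠ y in 𝓝[≠] x, u y ≠ 0) : IsEvenAt v x := by
  obtain ⟨s, hs⟩ := hu
  obtain ⟨t, ht⟩ := h
  refine ⟨fun y => t y / s y, ?_⟩
  filter_upwards [hs, ht, h0] with y h1 h2 h3
  have h4 : s y ≠ 0 := by
    intro h
    exact h3 (by rw [← h1.2, h]; simp)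
  refine ⟨h2.1.div₀ h1.1 h4, ?_⟩
  rw [div_pow, h1.2, h2.2]
  field_simp

theorem of_eq_norm (hu : Continuous u) (h : ∀ᶠ y in 𝓝[≠] x, u y = (‖u y‖ : ℂ)) :
    IsEvenAt u x := by
  refine ⟨fun y => (Real.sqrt ‖u y‖ : ℂ), ?_⟩
  filter_upwards [h] with y hy
  refine ⟨Continuous.continuousAt (by fun_prop), ?_⟩
  rw [← Complex.ofReal_pow, Real.sq_sqrt (norm_nonneg _), ← hy]

theorem of_ne_zero (hu : Continuous u) (h : u x ≠ 0) : IsEvenAt u x := by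
  refine ⟨fun y => Complex.exp (Complex.log (u y / u x) / 2) * Complex.exp (Complex.log (u x) / 2),
    ?_⟩
  have h1 : ∀ᶠ y in 𝓝 x, u y / u x ∈ Complex.slitPlane := by
    refine (IsOpen.preimage (by fun_prop : Continuous fun y => u y / u x)
      Complex.isOpen_slitPlane).mem_nhds ?_
    simp [div_self h]
  filter_upwards [nhdsWithin_le_nhds h1] with y hy
  refine ⟨?_, ?_⟩
  · have : ContinuousAt (fun y => Complex.log (u y / u x)) y :=
      ContinuousAt.clog (by fun_prop) hy
    fun_prop
  · rw [mul_pow, ← Complex.exp_nat_mul, ← Complex.exp_nat_mul]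
    push_cast
    rw [mul_div_cancel₀ _ (by norm_num), mul_div_cancel₀ _ (by norm_num),
      Complex.exp_log (Complex.slitPlane_ne_zero hy), Complex.exp_log h, div_mul_cancel₀ _ h]

theorem comp_isOpenEmbedding_iff {j : Y → X} (hj : IsOpenEmbedding j) {z : Y} :
    IsEvenAt (u ∘ j) z ↔ IsEvenAt u (j z) := by
  constructor
  · rintro ⟨s, hs⟩
    have : Nonempty Y := ⟨z⟩
    have hinv : ∀ y, Function.invFun j (j y) = y := Function.leftInverse_invFun hj.injective
    refine ⟨s ∘ Function.invFun j, ?_⟩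
    have hs' : ∀ᶠ y in 𝓝 z, y ≠ z → ContinuousAt s y ∧ s y ^ 2 = u (j y) :=
      eventually_nhdsWithin_iff.mp hs
    rw [eventually_nhdsWithin_iff, ← hj.map_nhds_eq, Filter.eventually_map]
    filter_upwards [hs'] with y hy hyz
    obtain ⟨h1, h2⟩ := hy (by rintro rfl; exact hyz rfl)
    refine ⟨hj.continuousAt_iff.mp ?_, by simpa [hinv] using h2⟩
    have : (s ∘ Function.invFun j) ∘ j = s := by
      ext y; simp [hinv]
    rwa [this]
  · rintro ⟨s, hs⟩
    refine ⟨s ∘ j, ?_⟩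
    rw [eventually_nhdsWithin_iff, ← hj.map_nhds_eq, Filter.eventually_map] at hs
    rw [eventually_nhdsWithin_iff]
    filter_upwards [hs] with y hy hyz
    obtain ⟨h1, h2⟩ := hy fun h => hyz (hj.injective h)
    exact ⟨hj.continuousAt_iff.mpr h1, h2⟩

theorem iff_even_of_eq_zpow_mul_exp {u : ℂ → ℂ} {q : ℂ} {r : ℝ} (hr : 0 < r) {n : ℤ} {L : ℂ → ℂ}
    (hL : ContinuousOn L (Metric.ball q r \ {q}))
    (hu : ∀ z ∈ Metric.ball q r \ {q}, u z = (z - q) ^ n * Complex.exp (L z)) :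
    IsEvenAt u q ↔ Even n := by
  have hopen : IsOpen (Metric.ball q r \ {q}) := Metric.isOpen_ball.sdiff isClosed_singleton
  constructor
  · rintro ⟨s, hs⟩
    obtain ⟨ε, hε, hs⟩ := Metric.mem_nhdsWithin_iff.mp hs
    set δ := min ε r with hδ
    have hδ0 : 0 < δ := lt_min hε hr
    have hsub : Metric.ball q δ \ {q} ⊆ Metric.ball q r \ {q} :=
      sdiff_subset_sdiff_left (Metric.ball_subset_ball (min_le_right _ _))
    have hs' : ∀ z ∈ Metric.ball q δ \ {q}, ContinuousAt s z ∧ s z ^ 2 = u z := fun z hz =>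
      hs ⟨Metric.ball_subset_ball (min_le_left _ _) hz.1, hz.2⟩
    obtain ⟨m, L', hL', hsL⟩ := exists_zpow_mul_exp_on_ball (u := s) hδ0
      (fun z hz => (hs' z hz).1.continuousWithinAt) (fun z hz h => by
        have h1 := (hs' z hz).2
        rw [h, hu z (hsub hz)] at h1
        simp [zpow_ne_zero _ (sub_ne_zero.mpr hz.2)] at h1)
    have hsph : Metric.sphere q (δ / 2) ⊆ Metric.ball q δ \ {q} := by
      intro z hz
      have h1 : dist z q = δ / 2 := hz
      refine ⟨by simp [h1, hδ0], ?_⟩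
      rintro rfl
      simp at h1
      linarith
    have := eq_zero_of_zpow_eq_exp_on_sphere (q := q) (half_pos hδ0) (N := 2 * m - n)
      (L := fun z => L z - 2 * L' z)
      (((hL.mono hsub).sub (continuousOn_const.mul hL')).mono hsph) (fun z hz => by
        have hz' := hsph hz
        have hzq : z - q ≠ 0 := sub_ne_zero.mpr hz'.2
        have h1 := (hs' z hz').2
        rw [hsL z hz', hu z (hsub hz'), mul_pow, ← Complex.exp_nat_mul, ← zpow_natCast,
          ← zpow_mul] at h1
        rw [zpow_sub₀ hzq, Complex.exp_sub, div_eq_div_iff (zpow_ne_zero _ hzq)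
          (Complex.exp_ne_zero _), mul_comm 2 m]
        push_cast at h1
        rw [h1]; ring)
    exact ⟨m, by omega⟩
  · rintro ⟨k, rfl⟩
    refine ⟨fun z => (z - q) ^ k * Complex.exp (L z / 2), ?_⟩
    have : Metric.ball q r \ {q} ∈ 𝓝[≠] q := by
      rw [sdiff_eq, inter_comm]
      exact inter_mem_nhdsWithin _ (Metric.ball_mem_nhds q hr)
    filter_upwards [this] with z hz
    have hzq : z - q ≠ 0 := sub_ne_zero.mpr hz.2
    refine ⟨?_, ?_⟩
    · have h1 := hL.continuousAt (hopen.mem_nhds hz)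
      have h2 : ContinuousAt (fun z => (z - q) ^ k) z :=
        ContinuousAt.zpow₀ (by fun_prop) _ (Or.inl hzq)
      exact h2.mul (h1.div_const 2).cexp
    · rw [hu z hz, mul_pow, ← Complex.exp_nat_mul, zpow_add₀ hzq, sq]
      push_cast
      rw [mul_div_cancel₀ _ (by norm_num)]

theorem mul_iff_planar {u v : ℂ → ℂ} {q : ℂ} (hu : Continuous u) (hv : Continuous v)
    (hu0 : ∀ᶠ z in 𝓝[≠] q, u z ≠ 0) (hv0 : ∀ᶠ z in 𝓝[≠] q, v z ≠ 0) :
    IsEvenAt (fun z => u z * v z) q ↔ (IsEvenAt u q ↔ IsEvenAt v q) := by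
  obtain ⟨r, hr, h⟩ := Metric.mem_nhdsWithin_iff.mp (hu0.and hv0)
  have h' : ∀ z ∈ Metric.ball q r \ {q}, u z ≠ 0 ∧ v z ≠ 0 := fun z hz => h hz
  obtain ⟨n, L, hL, hn⟩ := exists_zpow_mul_exp_on_ball hr hu.continuousOn fun z hz => (h' z hz).1
  obtain ⟨m, M, hM, hm⟩ := exists_zpow_mul_exp_on_ball hr hv.continuousOn fun z hz => (h' z hz).2
  rw [iff_even_of_eq_zpow_mul_exp hr hL hn, iff_even_of_eq_zpow_mul_exp hr hM hm,
    iff_even_of_eq_zpow_mul_exp hr (hL.add hM) (n := n + m), Int.even_add]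
  intro z hz
  rw [hn z hz, hm z hz, zpow_add₀ (sub_ne_zero.mpr hz.2), Pi.add_apply, Complex.exp_add]
  ring

theorem mul_iff {j : ℂ → X} (hj : IsOpenEmbedding j) (hx : x ∈ range j)
    (hu : Continuous u) (hv : Continuous v)
    (hu0 : ∀ᶠ z in 𝓝[≠] x, u z ≠ 0) (hv0 : ∀ᶠ z in 𝓝[≠] x, v z ≠ 0) :
    IsEvenAt (fun z => u z * v z) x ↔ (IsEvenAt u x ↔ IsEvenAt v x) := by
  obtain ⟨z, rfl⟩ := hx
  have key : ∀ w : X → ℂ, (∀ᶠ y in 𝓝[≠] (j z), w y ≠ 0) → ∀ᶠ y in 𝓝[≠] z, (w ∘ j) y ≠ 0 := by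
    intro w hw
    rw [eventually_nhdsWithin_iff, ← hj.map_nhds_eq, Filter.eventually_map] at hw
    rw [eventually_nhdsWithin_iff]
    filter_upwards [hw] with y hy hyz
    exact hy fun h => hyz (hj.injective h)
  rw [← comp_isOpenEmbedding_iff hj, ← comp_isOpenEmbedding_iff hj,
    ← comp_isOpenEmbedding_iff hj]
  exact mul_iff_planar (hu.comp hj.continuous) (hv.comp hj.continuous) (key u hu0) (key v hv0)

end IsEvenAt

theorem prod_zpow_eq_zpow_sum {ι : Type*} (Q : Finset ι) (n : ι → ℤ) {z : ℂ} (hz : z ≠ 0) :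
    ∏ q ∈ Q, z ^ n q = z ^ ∑ q ∈ Q, n q := by
  classical
  induction Q using Finset.induction_on with
  | empty => simp
  | insert q Q hq ih => rw [Finset.prod_insert hq, Finset.sum_insert hq, ih, zpow_add₀ hz]

theorem even_sum_iff_even_card {ι : Type*} (Q : Finset ι) (n : ι → ℤ) [DecidablePred fun q => ¬ Even (n q)] :
    Even (∑ q ∈ Q, n q) ↔ Even (Q.filter fun q => ¬ Even (n q)).card := by
  classical
  induction Q using Finset.induction_on with
  | empty => simp
  | insert q Q hq ih =>
    rw [Finset.sum_insert hq, Int.even_add, ih, Finset.filter_insert]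
    by_cases h : Even (n q)
    · simp [h]
    · rw [if_pos h, Finset.card_insert_of_notMem (by simp [hq]), Nat.even_add_one]
      tauto

/-- A continuous function on the plane which is `1` near infinity has an even number of zeros of
odd order. -/
theorem even_ncard_not_isEvenAt_planar {v : ℂ → ℂ} (hv : Continuous v) (hfin : {z | v z = 0}.Finite)
    {R : ℝ} (hR : ∀ z, R < ‖z‖ → v z = 1) : Even {z | ¬ IsEvenAt v z}.ncard := by
  classical
  set Q := hfin.toFinset with hQ
  have hQm : ∀ z, z ∈ Q ↔ v z = 0 := fun z => by simp [hQ]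
  obtain ⟨n, L, hL, h⟩ := exists_prod_zpow_mul_exp Q v hv.continuousOn fun z hz => by
    rwa [hQm] at hz
  have hloc : ∀ q ∈ Q, (IsEvenAt v q ↔ Even (n q)) := by
    intro q hq
    obtain ⟨r, hr, hrQ⟩ : ∃ r > 0, Metric.ball q r ⊆ ((Q.erase q : Finset ℂ) : Set ℂ)ᶜ :=
      Metric.isOpen_iff.mp (Finset.finite_toSet _).isClosed.isOpen_compl q (by simp)
    have hz0 : ∀ z ∈ Metric.ball q r, ∀ x ∈ Q.erase q, z - x ≠ 0 := by
      intro z hz x hx h0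
      exact hrQ hz (by rwa [sub_eq_zero.mp h0])
    obtain ⟨M, hM, hMe⟩ := exists_exp_eqOn_of_convex (convex_ball q r)
      (u := fun z => ∏ x ∈ Q.erase q, (z - x) ^ n x)
      (by
        refine continuousOn_finsetProd _ fun x hx => ?_
        exact ContinuousOn.zpow₀ (by fun_prop) _ fun z hz => Or.inl (hz0 z hz x hx))
      (fun z hz => Finset.prod_ne_zero_iff.mpr fun x hx => zpow_ne_zero _ (hz0 z hz x hx))
    have hzQ : ∀ z ∈ Metric.ball q r \ {q}, z ∉ Q := by
      rintro z ⟨hz, hzq⟩ hzQ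
      exact hrQ hz (by simpa using And.intro hzQ (show z ≠ q from hzq))
    refine IsEvenAt.iff_even_of_eq_zpow_mul_exp hr (L := fun z => M z + L z)
      ((hM.mono sdiff_subset).add (hL.mono fun z hz => by simpa using hzQ z hz)) fun z hz => ?_
    rw [h z (hzQ z hz), ← Finset.mul_prod_erase Q _ hq, Complex.exp_add, ← hMe z hz.1]
    ring
  have hsum : ∑ q ∈ Q, n q = 0 := by
    obtain ⟨c, hc⟩ : ∃ c : ℝ, 0 < c ∧ R < c ∧ ∀ q ∈ Q, ‖q‖ < c := by
      refine ⟨1 + |R| + ∑ q ∈ Q, ‖q‖, ?_, ?_, fun q hq => ?_⟩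
      · positivity
      · have := le_abs_self R
        have : 0 ≤ ∑ q ∈ Q, ‖q‖ := by positivity
        linarith
      · have := Finset.single_le_sum (f := fun q : ℂ => ‖q‖) (fun q _ => norm_nonneg q) hq
        have := abs_nonneg R
        linarith
    obtain ⟨hc0, hcR, hcQ⟩ := hc
    have hz0 : ∀ z ∈ Metric.sphere (0 : ℂ) c, z ≠ 0 := by
      rintro z hz rfl
      simp at hz
      linarith
    have hslit : ∀ z ∈ Metric.sphere (0 : ℂ) c, ∀ q ∈ Q, 1 - q / z ∈ Complex.slitPlane := by
      intro z hz q hq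
      have h1 : ‖-(q / z)‖ < 1 := by
        rw [norm_neg, norm_div, div_lt_one (norm_pos_iff.mpr (hz0 z hz))]
        simpa [mem_sphere_zero_iff_norm.mp hz] using hcQ q hq
      simpa [sub_eq_add_neg] using Complex.mem_slitPlane_of_norm_lt_one h1
    refine eq_zero_of_zpow_eq_exp_on_sphere hc0 (q := 0)
      (L := fun z => -(∑ q ∈ Q, n q * Complex.log (1 - q / z) + L z)) ?_ fun z hz => ?_
    · refine (ContinuousOn.add (continuousOn_finsetSum _ fun q hq => ?_) (hL.mono ?_)).neg
      · refine continuousOn_const.mul (ContinuousOn.clog ?_ fun z hz => hslit z hz q hq)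
        exact continuousOn_const.sub (continuousOn_const.div continuousOn_id hz0)
      · intro z hz hzQ
        have := hcQ z hzQ
        rw [mem_sphere_zero_iff_norm.mp hz] at this
        exact lt_irrefl _ this
    · have hzQ : z ∉ Q := by
        intro hzQ
        have := hcQ z hzQ
        rw [mem_sphere_zero_iff_norm.mp hz] at this
        exact lt_irrefl _ this
      have h1 := h z hzQ
      rw [hR z (by rw [mem_sphere_zero_iff_norm.mp hz]; exact hcR)] at h1
      have h2 : ∏ q ∈ Q, (z - q) ^ n q =
          z ^ (∑ q ∈ Q, n q) * Complex.exp (∑ q ∈ Q, n q * Complex.log (1 - q / z)) := by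
        rw [Complex.exp_sum, ← prod_zpow_eq_zpow_sum Q n (hz0 z hz), ← Finset.prod_mul_distrib]
        refine Finset.prod_congr rfl fun q hq => ?_
        rw [Complex.exp_int_mul, Complex.exp_log (Complex.slitPlane_ne_zero (hslit z hz q hq)),
          ← mul_zpow, mul_sub, mul_one, mul_div_cancel₀ _ (hz0 z hz)]
      rw [h2, mul_assoc, ← Complex.exp_add] at h1
      rw [sub_zero, Complex.exp_neg]
      exact eq_inv_of_mul_eq_one_left h1.symm
  have hset : {z | ¬ IsEvenAt v z} = (Q.filter fun q => ¬ Even (n q) : Finset ℂ) := by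
    ext z
    simp only [Set.mem_ofPred_eq, Finset.coe_filter]
    constructor
    · intro hz
      have hzQ : z ∈ Q := by
        rw [hQm]
        by_contra h0
        exact hz (.of_ne_zero hv h0)
      exact ⟨hzQ, by rwa [← hloc z hzQ]⟩
    · rintro ⟨hzQ, hz⟩
      rwa [hloc z hzQ]
  rw [hset, Set.ncard_coe_finset, ← even_sum_iff_even_card Q n, hsum]
  exact Even.zero

/-- A `C¹` self-map of the plane has arbitrarily small values attained only finitely often on each
compact set. -/
theorem exists_small_finite_fiber {G : ℂ → ℂ} (hG : ContDiff ℝ 1 G) {ε : ℝ} (hε : 0 < ε)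
    {E : Set ℂ} (hE : IsCompact E) : ∃ c : ℂ, ‖c‖ < ε ∧ {z ∈ E | G z = c}.Finite := by
  have hd : ∀ z, HasFDerivAt G (fderiv ℝ G z) z := fun z =>
    (hG.differentiable one_ne_zero z).hasFDerivAt
  have hnull := MeasureTheory.addHaar_image_eq_zero_of_det_fderivWithin_eq_zero
    MeasureTheory.volume (s := {z | (fderiv ℝ G z).det = 0}) (f := G)
    (fun z _ => (hd z).hasFDerivWithinAt) fun z hz => hz
  obtain ⟨c, hcε, hc⟩ : ∃ c ∈ Metric.ball (0 : ℂ) ε, c ∉ G '' {z | (fderiv ℝ G z).det = 0} := by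
    by_contra! h
    have h1 := MeasureTheory.measure_mono_null (μ := MeasureTheory.volume) h hnull
    exact (Metric.measure_ball_pos MeasureTheory.volume (0 : ℂ) hε).ne' h1
  refine ⟨c, by simpa using hcε, ?_⟩
  by_contra hinf
  have hT : IsCompact {z ∈ E | G z = c} :=
    hE.inter_right (isClosed_singleton.preimage hG.continuous : IsClosed {z | G z = c})
  obtain ⟨z, hz, hacc⟩ := Set.Infinite.exists_accPt_of_subset_isCompact hinf hT subset_rfl
  have hdet : (fderiv ℝ G z).det ≠ 0 := fun h => hc ⟨z, h, hz.2⟩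
  have hev := (hd z).eventually_ne (c := c)
    ⟨_, ((fderiv ℝ G z).toContinuousLinearEquivOfDetNeZero hdet).antilipschitz⟩
  exact accPt_iff_frequently_nhdsNE.mp hacc (hev.mono fun y hy hyT => hy hyT.2)

/-- A continuous self-map of the plane can be perturbed near a compact set of zeros so that only
finitely many zeros remain. -/
theorem exists_finite_zeros_perturbation {F : ℂ → ℂ} (hF : Continuous F) {E O : Set ℂ}
    (hE : IsCompact E) (hO : IsOpen O) (hEO : E ⊆ O) (hfin : ({z | F z = 0} \ E).Finite) :
    ∃ (v : ℂ → ℂ) (L : Set ℂ), Continuous v ∧ IsCompact L ∧ L ⊆ O ∧ (∀ z ∉ L, v z = F z) ∧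
      {z | v z = 0}.Finite := by
  obtain ⟨L, hL, hEL, hLO⟩ := exists_compact_between hE (hO.sdiff hfin.isClosed)
    fun z hz => ⟨hEO hz, fun h => h.2 hz⟩
  obtain ⟨E1, hE1, hEE1, hE1L⟩ := exists_compact_between hE isOpen_interior hEL
  obtain ⟨μ, hμ1, hμ0, -, hμ⟩ := exists_continuous_one_zero_of_isCompact hE1
    isOpen_interior.isClosed_compl (disjoint_compl_right_iff_subset.mpr hE1L)
  have hne : ∀ z ∈ L \ interior E1, F z ≠ 0 := by
    rintro z ⟨hzL, hzE⟩ h0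
    exact (hLO hzL).2 ⟨h0, fun h => hzE (hEE1 h)⟩
  obtain ⟨δ, hδ, hFδ⟩ : ∃ δ > 0, ∀ z ∈ L \ interior E1, δ ≤ ‖F z‖ := by
    rcases (L \ interior E1).eq_empty_or_nonempty with h | h
    · exact ⟨1, one_pos, by simp [h]⟩
    · obtain ⟨z, hz, hmin⟩ := (hL.diff isOpen_interior).exists_isMinOn h hF.norm.continuousOn
      exact ⟨‖F z‖, norm_pos_iff.mpr (hne z hz), fun y hy => hmin hy⟩
  obtain ⟨G, hG, hGF, -⟩ := hF.exists_contDiff_approx (ε := fun _ => δ / 2) 1 continuous_const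
    fun _ => half_pos hδ
  obtain ⟨c, hc, hcfin⟩ := exists_small_finite_fiber (mod_cast hG) (half_pos hδ) hE1
  refine ⟨fun z => F z + μ z * (G z - c - F z), L, ?_, hL, hLO.trans sdiff_subset, ?_, ?_⟩
  · have := hG.continuous
    fun_prop
  · intro z hz
    have : μ z = 0 := hμ0 fun h => hz (interior_subset h)
    simp [this]
  · refine (hcfin.union hfin).subset fun z hz => ?_
    have hz' : F z + μ z * (G z - c - F z) = 0 := hz
    by_cases hz1 : z ∈ E1
    · left
      refine ⟨hz1, ?_⟩
      have : μ z = 1 := hμ1 hz1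
      rw [this] at hz'
      push_cast at hz'
      linear_combination hz'
    by_cases hzL : z ∈ L
    · exfalso
      have h1 := hFδ z ⟨hzL, fun h => hz1 (interior_subset h)⟩
      have h2 : ‖G z - F z‖ < δ / 2 := by simpa [dist_eq_norm] using hGF z
      have h3 : F z = -(μ z * ((G z - F z) - c)) := by linear_combination hz'
      rw [h3, norm_neg, norm_mul, Complex.norm_real, Real.norm_of_nonneg (hμ z).1] at h1
      have h4 := norm_sub_le (G z - F z) c
      nlinarith [(hμ z).1, (hμ z).2, norm_nonneg (G z - F z - c)]
    · right
      have : μ z = 0 := hμ0 fun h => hzL (interior_subset h)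
      rw [this] at hz'
      exact ⟨by simpa using hz', fun h => hzL (interior_subset (hEL h))⟩

theorem even_ncard_of_symmDiff {X : Type*} {B C : Set X} (hB : B.Finite) (hC : C.Finite)
    (h1 : Even C.ncard) (h2 : Even (symmDiff B C).ncard) : Even B.ncard := by
  have e1 := Set.ncard_inter_add_ncard_sdiff_eq_ncard B C hB
  have e2 := Set.ncard_inter_add_ncard_sdiff_eq_ncard C B hC
  have e3 : (symmDiff B C).ncard = (B \ C).ncard + (C \ B).ncard :=
    Set.ncard_union_eq disjoint_sdiff_sdiff (hB.subset sdiff_subset) (hC.subset sdiff_subset)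
  rw [inter_comm] at e2
  rw [e3] at h2
  rw [Nat.even_iff] at *
  omega

/-- Modification of a continuous function on the range of an open embedding. -/
theorem exists_extension_of_eqOn_compl {W X : Type*} [TopologicalSpace W] [TopologicalSpace X]
    [T2Space X] {j : W → X} (hj : IsOpenEmbedding j) {v : W → ℂ} (hv : Continuous v) {g : X → ℂ}
    (hg : Continuous g) {C : Set W} (hC : IsCompact C) (h : ∀ z ∉ C, v z = g (j z)) :
    ∃ w : X → ℂ, Continuous w ∧ (∀ z, w (j z) = v z) ∧ ∀ x ∉ j '' C, w x = g x := by
  have hwj : ∀ z, Function.extend j v g (j z) = v z := hj.injective.extend_apply v g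
  have hwg : ∀ x ∉ j '' C, Function.extend j v g x = g x := by
    intro x hx
    by_cases hxr : x ∈ range j
    · obtain ⟨z, rfl⟩ := hxr
      rw [hwj]
      exact h z fun hz => hx ⟨z, hz, rfl⟩
    · exact Function.extend_apply' _ _ _ hxr
  refine ⟨Function.extend j v g, ?_, hwj, hwg⟩
  rw [continuous_iff_continuousAt]
  intro x
  by_cases hx : x ∈ j '' C
  · obtain ⟨z, -, rfl⟩ := hx
    rw [← hj.continuousAt_iff, show Function.extend j v g ∘ j = v from funext hwj]
    exact hv.continuousAt
  · refine hg.continuousAt.congr ?_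
    filter_upwards [(hC.image hj.continuous).isClosed.isOpen_compl.mem_nhds hx] with y hy
    exact (hwg y hy).symm

theorem IsEvenAt.mul_iff_right {X : Type*} [TopologicalSpace X] {u v : X → ℂ} {x : X}
    (hv : Continuous v) (h : v x ≠ 0) : IsEvenAt (fun y => u y * v y) x ↔ IsEvenAt u x := by
  refine ⟨fun hm => ?_, fun hu => hu.mul (.of_ne_zero hv h)⟩
  refine IsEvenAt.of_mul_left (u := v) (hm.congr (.of_forall fun y => mul_comm _ _))
    (.of_ne_zero hv h) (nhdsWithin_le_nhds ?_)
  exact (isOpen_ne.preimage hv).mem_nhds h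

theorem eventually_ne_zero_of_finite {X : Type*} [TopologicalSpace X] [T1Space X] {u : X → ℂ}
    (hfin : {x | u x = 0}.Finite) (x : X) : ∀ᶠ y in 𝓝[≠] x, u y ≠ 0 := by
  have : IsClosed ({x | u x = 0} \ {x}) := (hfin.subset sdiff_subset).isClosed
  rw [eventually_nhdsWithin_iff]
  filter_upwards [this.isOpen_compl.mem_nhds (by simp : x ∈ ({x | u x = 0} \ {x})ᶜ)] with y hy hyx h
  exact hy ⟨h, hyx⟩

theorem finite_not_isEvenAt {X : Type*} [TopologicalSpace X] {u : X → ℂ} (hu : Continuous u)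
    (hfin : {x | u x = 0}.Finite) : {x | ¬ IsEvenAt u x}.Finite :=
  hfin.subset fun _ hx => by_contra fun h => hx (.of_ne_zero hu h)

/-- A continuous function with finitely many zeros, nonnegative off a compact set covered by open
disks, has an even number of zeros of odd order. -/
theorem even_ncard_not_isEvenAt {X : Type*} [TopologicalSpace X] [T2Space X] (J : List (ℂ → X)) :
    (∀ j ∈ J, IsOpenEmbedding j) → ∀ (K : Set X) (u : X → ℂ), IsCompact K →
      (K ⊆ ⋃ j ∈ J, range j) → Continuous u → {x | u x = 0}.Finite →
      (∀ x ∉ K, u x = (‖u x‖ : ℂ)) → Even {x | ¬ IsEvenAt u x}.ncard := by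
  induction J with
  | nil =>
    intro _ K u hK hKJ hu hfin h
    have hK0 : K = ∅ := by simpa using hKJ
    have : {x | ¬ IsEvenAt u x} = ∅ := by
      refine eq_empty_iff_forall_notMem.mpr fun x hx => hx (.of_eq_norm hu ?_)
      exact .of_forall fun y => h y (by simp [hK0])
    simp [this]
  | cons j J ih =>
    intro hJ K u hK hKJ hu hfin h
    have hj : IsOpenEmbedding j := hJ j (by simp)
    set U : Set X := ⋃ i ∈ J, range i with hU
    have hUo : IsOpen U := isOpen_biUnion fun i hi => (hJ i (List.mem_cons_of_mem _ hi)).isOpen_range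
    have hKU : K \ U ⊆ range j := by
      rintro x ⟨hx, hxU⟩
      have := hKJ hx
      simp only [List.mem_cons, iUnion_iUnion_eq_or_left] at this
      exact this.resolve_right hxU
    have hA : IsCompact (j ⁻¹' (K \ U)) :=
      hj.isInducing.isCompact_preimage' (hK.diff hUo) hKU
    obtain ⟨N, hN, hAN, -⟩ := exists_compact_between hA isOpen_univ (subset_univ _)
    obtain ⟨N0, hN0, hAN0, hN0N⟩ := exists_compact_between hA isOpen_interior hAN
    obtain ⟨B, hB, hNB, -⟩ := exists_compact_between hN isOpen_univ (subset_univ _)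
    obtain ⟨η, hη1, hη0, -, hη⟩ := exists_continuous_one_zero_of_isCompact hN
      isOpen_interior.isClosed_compl (disjoint_compl_right_iff_subset.mpr hNB)
    set F : ℂ → ℂ := fun z => η z * u (j z) + (1 - η z) with hFdef
    have hF : Continuous F := by
      have := hj.continuous
      fun_prop
    have hFK : ∀ z, j z ∉ K → F z = ((η z * ‖u (j z)‖ + (1 - η z) : ℝ) : ℂ) := by
      intro z hz
      simp only [hFdef]
      rw [h _ hz]
      simp
    set E : Set ℂ := ({z | F z = 0} ∩ j ⁻¹' K) \ interior N with hE
    have hEc : IsCompact E := by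
      refine hB.of_isClosed_subset ?_ ?_
      · exact ((isClosed_singleton.preimage hF).inter
          (hK.isClosed.preimage hj.continuous)).sdiff isOpen_interior
      · rintro z ⟨⟨hz, -⟩, -⟩
        by_contra hzB
        have : η z = 0 := hη0 fun h => hzB (interior_subset h)
        simp [hFdef, this] at hz
    obtain ⟨v, L, hv, hL, hLO, hvF, hvfin⟩ := exists_finite_zeros_perturbation hF hEc
      ((hUo.preimage hj.continuous).sdiff hN0.isClosed) (by
        rintro z ⟨⟨hz, hzK⟩, hzN⟩
        refine ⟨?_, fun h => hzN (hN0N.trans (by rfl) h)⟩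
        by_contra hzU
        exact hzN (hAN ⟨hzK, hzU⟩)) (by
        refine (hfin.preimage hj.injective.injOn).subset ?_
        rintro z ⟨hz, hzE⟩
        change u (j z) = 0
        by_cases hzN : z ∈ interior N
        · have : η z = 1 := hη1 (interior_subset hzN)
          simpa [hFdef, this] using hz
        · have hzK : j z ∉ K := fun hzK => hzE ⟨⟨hz, hzK⟩, hzN⟩
          have h1 := hFK z hzK
          rw [show F z = 0 from hz] at h1
          have h2 : η z * ‖u (j z)‖ + (1 - η z) = 0 := by exact_mod_cast h1.symm
          have h3 : η z = 1 := by
            nlinarith [(hη z).1, (hη z).2, mul_nonneg (hη z).1 (norm_nonneg (u (j z)))]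
          rw [h3] at h2
          simpa using h2)
    have hv1 : ∀ z ∉ B ∪ L, v z = 1 := by
      intro z hz
      rw [hvF z fun h => hz (Or.inr h)]
      have : η z = 0 := hη0 fun h => hz (Or.inl (interior_subset h))
      simp [hFdef, this]
    obtain ⟨w, hw, hwj, hw1⟩ := exists_extension_of_eqOn_compl hj hv (continuous_const (y := (1 : ℂ)))
      (hB.union hL) hv1
    have hwfin : {x | w x = 0}.Finite := by
      refine (hvfin.image j).subset fun x hx => ?_
      have hx0 : w x = 0 := hx
      have : x ∈ j '' (B ∪ L) := by
        by_contra hx'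
        simp [hw1 x hx'] at hx0
      obtain ⟨z, -, rfl⟩ := this
      exact ⟨z, by rw [← hx0, hwj]; rfl, rfl⟩
    have hN0o : IsOpen (j '' interior N0) := hj.isOpenMap _ isOpen_interior
    have hKUc : IsCompact (K \ j '' interior N0 ∪ j '' L) :=
      (hK.diff hN0o).union (hL.image hj.continuous)
    have hprod := ih (fun i hi => hJ i (by simp [hi])) (K \ j '' interior N0 ∪ j '' L)
      (fun x => u x * star (w x)) hKUc (by
        rintro x (⟨hxK, hx⟩ | ⟨z, hz, rfl⟩)
        · by_contra hxU
          obtain ⟨z, rfl⟩ := hKU ⟨hxK, hxU⟩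
          exact hx ⟨z, hAN0 ⟨hxK, hxU⟩, rfl⟩
        · exact (hLO hz).1) (by fun_prop) (by
        refine (hfin.union hwfin).subset fun x hx => ?_
        simpa using hx) (by
        intro x hx
        by_cases hxr : x ∈ range j
        · obtain ⟨z, rfl⟩ := hxr
          have hzL : z ∉ L := fun hz => hx (Or.inr ⟨z, hz, rfl⟩)
          rw [hwj, hvF z hzL]
          by_cases hzK : j z ∈ K
          · have hzN : z ∈ interior N0 := by
              by_contra hzN
              refine hx (Or.inl ⟨hzK, ?_⟩)
              rintro ⟨y, hy, hyz⟩
              exact hzN (hj.injective hyz ▸ hy)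
            have : η z = 1 := hη1 (interior_subset (hN0N (interior_subset hzN)))
            simp only [hFdef, this]
            simp [Complex.mul_conj, Complex.normSq_eq_norm_sq, sq]
          · rw [hFK z hzK, h _ hzK]
            have : 0 ≤ η z * ‖u (j z)‖ + (1 - η z) :=
              add_nonneg (mul_nonneg (hη z).1 (norm_nonneg _)) (sub_nonneg.mpr (hη z).2)
            rw [RCLike.star_def, Complex.conj_ofReal, norm_mul, Complex.norm_real, Complex.norm_real,
              norm_norm, Real.norm_of_nonneg this]
            push_cast
            rfl
        · have hxK : x ∉ K := by
            intro hxK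
            refine hx (Or.inl ⟨hxK, ?_⟩)
            rintro ⟨y, -, rfl⟩
            exact hxr ⟨y, rfl⟩
          have : w x = 1 := hw1 x fun ⟨y, _, hy⟩ => hxr ⟨y, hy⟩
          simpa [this] using h x hxK)
    obtain ⟨R, hR⟩ := (hB.union hL).isBounded.exists_norm_le
    have hveven := even_ncard_not_isEvenAt_planar hv hvfin (R := R) fun z hz =>
      hv1 z fun hzC => (hR z hzC).not_gt hz
    have himage : {x | ¬ IsEvenAt w x} = j '' {z | ¬ IsEvenAt v z} := by
      have hcomp : w ∘ j = v := funext hwj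
      ext x
      constructor
      · intro hx
        by_cases hx' : x ∈ j '' (B ∪ L)
        · obtain ⟨z, -, rfl⟩ := hx'
          refine ⟨z, ?_, rfl⟩
          rwa [Set.mem_ofPred_eq, ← IsEvenAt.comp_isOpenEmbedding_iff hj, hcomp] at hx
        · exact absurd (IsEvenAt.of_ne_zero hw (by simp [hw1 x hx'])) hx
      · rintro ⟨z, hz, rfl⟩
        rwa [Set.mem_ofPred_eq, ← IsEvenAt.comp_isOpenEmbedding_iff hj, hcomp]
    refine even_ncard_of_symmDiff (C := {x | ¬ IsEvenAt w x}) (finite_not_isEvenAt hu hfin)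
      (finite_not_isEvenAt hw hwfin) ?_ ?_
    · rwa [himage, ncard_image_of_injective _ hj.injective]
    · convert hprod using 2
      ext x
      have key : IsEvenAt (fun x => u x * star (w x)) x ↔ (IsEvenAt u x ↔ IsEvenAt w x) := by
        by_cases hx : x ∈ range j
        · rw [IsEvenAt.mul_iff hj hx hu hw.star (eventually_ne_zero_of_finite hfin x)
            ((eventually_ne_zero_of_finite hwfin x).mono fun y hy => by simpa using hy),
            IsEvenAt.conj_iff]
        · have hwx : w x = 1 := hw1 x fun ⟨y, _, hy⟩ => hx ⟨y, hy⟩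
          rw [IsEvenAt.mul_iff_right hw.star (by simp [hwx])]
          have : IsEvenAt w x := .of_ne_zero hw (by simp [hwx])
          tauto
      simp only [mem_symmDiff, Set.mem_ofPred_eq, key]
      tauto

theorem isOpenEmbedding_of_isEmbedding_val {W T : Type*} [TopologicalSpace W] [TopologicalSpace T]
    {p : T → Prop} {g : W → Subtype p} (hg : IsEmbedding fun w => (g w : T)) {O : Set T}
    (hO : IsOpen O) (hr : ∀ t, (∃ w, g w = t) ↔ (t : T) ∈ O) : IsOpenEmbedding g := by
  have hc : Continuous g := IsEmbedding.subtypeVal.continuous_iff.mpr hg.continuous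
  refine ⟨.of_comp hc continuous_subtype_val hg, ?_⟩
  have : range g = Subtype.val ⁻¹' O := by
    ext t
    exact hr t
  rw [this]
  exact hO.preimage continuous_subtype_val

/-- The closed half-plane. -/
abbrev HalfPlane : Type := {p : ℝ × ℝ // 0 ≤ p.2}

theorem isOpenEmbedding_equivRealProd : IsOpenEmbedding fun z : ℂ => (z.re, z.im) :=
  Complex.equivRealProdCLM.toHomeomorph.isOpenEmbedding

theorem exists_isOpenEmbedding_ball (c : ℂ) {r : ℝ} (hr : 0 < r) :
    ∃ ψ : ℂ → ℂ, IsOpenEmbedding ψ ∧ range ψ = Metric.ball c r := by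
  refine ⟨OpenPartialHomeomorph.univBall c r, OpenPartialHomeomorph.isOpenEmbedding _
    (OpenPartialHomeomorph.univBall_source c r), ?_⟩
  rw [← OpenPartialHomeomorph.univBall_target c hr, ← OpenPartialHomeomorph.image_source_eq_target,
    OpenPartialHomeomorph.univBall_source, image_univ]

theorem exists_plane_chart_of_pos {O : Set (ℝ × ℝ)} (hO : IsOpen O) {p : HalfPlane}
    (hp : (p : ℝ × ℝ) ∈ O) (hpos : 0 < p.1.2) :
    ∃ g : ℂ → HalfPlane, IsOpenEmbedding g ∧ p ∈ range g ∧ ∀ z, (g z : ℝ × ℝ) ∈ O := by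
  have ho : IsOpen {z : ℂ | (z.re, z.im) ∈ O ∧ 0 < z.im} :=
    (hO.preimage isOpenEmbedding_equivRealProd.continuous).inter
      (isOpen_lt continuous_const Complex.continuous_im)
  obtain ⟨r, hr, hball⟩ := Metric.isOpen_iff.mp ho ⟨p.1.1, p.1.2⟩ ⟨hp, hpos⟩
  obtain ⟨ψ, hψ, hrange⟩ := exists_isOpenEmbedding_ball ⟨p.1.1, p.1.2⟩ hr
  have hmem : ∀ z, ((ψ z).re, (ψ z).im) ∈ O ∧ 0 < (ψ z).im := fun z =>
    hball (hrange ▸ mem_range_self z)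
  have hcomp : IsOpenEmbedding fun z => ((ψ z).re, (ψ z).im) :=
    isOpenEmbedding_equivRealProd.comp hψ
  refine ⟨fun z => ⟨((ψ z).re, (ψ z).im), (hmem z).2.le⟩, ?_, ?_, fun z => (hmem z).1⟩
  · refine isOpenEmbedding_of_isEmbedding_val hcomp.isEmbedding hcomp.isOpen_range fun t => ?_
    simp only [Subtype.ext_iff, mem_range]
  · have : (⟨p.1.1, p.1.2⟩ : ℂ) ∈ range ψ := by
      rw [hrange]; exact Metric.mem_ball_self hr
    obtain ⟨z, hz⟩ := this
    exact ⟨z, by simp [hz]⟩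

theorem exists_halfPlane_chart_of_eq_zero {O : Set (ℝ × ℝ)} (hO : IsOpen O) {a : ℝ}
    (ha : (a, 0) ∈ O) :
    ∃ g : HalfPlane → HalfPlane, IsOpenEmbedding g ∧ g ⟨(0, 0), le_rfl⟩ = ⟨(a, 0), le_rfl⟩ ∧
      ∀ z, (g z : ℝ × ℝ) ∈ O := by
  obtain ⟨ε, hε, hball⟩ := Metric.isOpen_iff.mp hO (a, 0) ha
  set s := OpenPartialHomeomorph.univBall (E := ℝ) a ε with hs
  have hse : IsOpenEmbedding s :=
    OpenPartialHomeomorph.isOpenEmbedding _ (OpenPartialHomeomorph.univBall_source a ε)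
  have hsb : ∀ x, s x ∈ Metric.ball a ε := by
    intro x
    rw [← OpenPartialHomeomorph.univBall_target a hε]
    exact s.map_source (by simp [hs])
  set τ : ℝ → ℝ := fun y => -ε * Real.exp (-y) + ε with hτ
  have hτe : IsOpenEmbedding τ :=
    (affineHomeomorph (-ε) ε (by linarith)).isOpenEmbedding.comp
      (Real.isOpenEmbedding_exp.comp (Homeomorph.neg ℝ).isOpenEmbedding)
  have hτ0 : ∀ y, 0 ≤ τ y ↔ 0 ≤ y := by
    intro y
    have : 0 ≤ τ y ↔ 0 ≤ ε * (1 - Real.exp (-y)) := by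
      rw [hτ]; ring_nf
    rw [this, mul_nonneg_iff_of_pos_left hε, sub_nonneg, Real.exp_le_one_iff]
    simp
  have hτε : ∀ y, τ y < ε := by
    intro y
    have := mul_pos hε (Real.exp_pos (-y))
    simp only [hτ]
    linarith
  have hΦ := hse.prodMap hτe
  refine ⟨fun p => ⟨Prod.map s τ p.1, (hτ0 _).mpr p.2⟩, ?_, ?_, fun p => ?_⟩
  · refine isOpenEmbedding_of_isEmbedding_val (hΦ.isEmbedding.comp .subtypeVal) hΦ.isOpen_range
      fun t => ?_
    simp only [Subtype.ext_iff, mem_range]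
    constructor
    · rintro ⟨w, hw⟩
      exact ⟨w, hw⟩
    · rintro ⟨w, hw⟩
      refine ⟨⟨w, ?_⟩, hw⟩
      rw [← hτ0]
      have := t.2
      rw [← hw] at this
      exact this
  · apply Subtype.ext
    simp [Prod.map, hτ, hs, OpenPartialHomeomorph.univBall_apply_zero]
  · refine hball ?_
    rw [Metric.mem_ball, Prod.dist_eq, max_lt_iff]
    refine ⟨hsb _, ?_⟩
    have h1 : 0 ≤ τ p.1.2 := (hτ0 _).mpr p.2
    change dist (τ p.1.2) 0 < ε
    rw [Real.dist_eq, sub_zero, abs_of_nonneg h1]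
    exact hτε _

/-- Every point of a surface lies in an open disk or is the centre of an open half-disk. -/
theorem IsSurface.exists_chart {S : Type*} [TopologicalSpace S] (hS : IsSurface S) (x : S) :
    (∃ j : ℂ → S, IsOpenEmbedding j ∧ x ∈ range j) ∨
      ∃ k : HalfPlane → S, IsOpenEmbedding k ∧ k ⟨(0, 0), le_rfl⟩ = x := by
  obtain ⟨U, V, hU, hxU, hV, ⟨e⟩⟩ := hS.locallyHalfPlane x
  have hi : IsOpenEmbedding fun v : V => (e.symm v : S) :=
    hU.isOpenEmbedding_subtypeVal.comp e.symm.isOpenEmbedding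
  obtain ⟨O, hO, rfl⟩ := isOpen_induced_iff.mp hV
  set p := e ⟨x, hxU⟩ with hp
  have hpx : (e.symm p : S) = x := by simp [hp]
  have lift : ∀ {W : Type} [TopologicalSpace W] (g : W → HalfPlane), IsOpenEmbedding g →
      (h : ∀ w, (g w : ℝ × ℝ) ∈ O) →
      IsOpenEmbedding fun w : W => (e.symm ⟨g w, h w⟩ : S) := by
    intro W _ g hg h
    refine hi.comp (isOpenEmbedding_of_isEmbedding_val hg.isEmbedding hg.isOpen_range fun t => ?_)
    simp only [Subtype.ext_iff, mem_range]
  rcases p.1.2.lt_or_eq with hpos | h0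
  · left
    obtain ⟨g, hg, ⟨z, hz⟩, hgO⟩ := exists_plane_chart_of_pos hO p.2 hpos
    refine ⟨_, lift g hg hgO, z, ?_⟩
    rw [← hpx]
    exact congrArg (fun v => (e.symm v : S)) (Subtype.ext hz)
  · right
    have hp0 : (p.1 : ℝ × ℝ) = (p.1.1.1, 0) := Prod.ext rfl h0.symm
    obtain ⟨g, hg, hz, hgO⟩ := exists_halfPlane_chart_of_eq_zero hO (a := p.1.1.1)
      (hp0 ▸ p.2)
    refine ⟨_, lift g hg hgO, ?_⟩
    rw [← hpx]
    exact congrArg (fun v => (e.symm v : S)) (Subtype.ext (hz.trans (Subtype.ext hp0.symm)))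

theorem notMem_Bd_iff {S : Type*} [TopologicalSpace S] {x : S} :
    x ∉ Bd S ↔ ∃ j : ℂ → S, IsOpenEmbedding j ∧ x ∈ range j := by
  simp only [Bd, Set.mem_ofPred_eq, not_not]
  constructor
  · rintro ⟨U, hU, hx, ⟨e⟩⟩
    refine ⟨fun z => e.symm (z.re, z.im), (hU.isOpenEmbedding_subtypeVal.comp
      e.symm.isOpenEmbedding).comp isOpenEmbedding_equivRealProd, ?_⟩
    refine ⟨⟨(e ⟨x, hx⟩).1, (e ⟨x, hx⟩).2⟩, ?_⟩
    simp
  · rintro ⟨j, hj, hx⟩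
    exact ⟨range j, hj.isOpen_range, hx,
      ⟨hj.isEmbedding.toHomeomorph.symm.trans Complex.equivRealProdCLM.toHomeomorph⟩⟩

theorem IsEvenAt.comp {X Y : Type*} [TopologicalSpace X] [TopologicalSpace Y] {u : X → ℂ}
    {κ : Y → X} (hκ : Continuous κ) {z : Y} (hne : ∀ᶠ y in 𝓝[≠] z, κ y ≠ κ z)
    (hu : IsEvenAt u (κ z)) : IsEvenAt (u ∘ κ) z := by
  obtain ⟨s, hs⟩ := hu
  have ht : Filter.Tendsto κ (𝓝[≠] z) (𝓝[≠] (κ z)) :=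
    tendsto_nhdsWithin_iff.mpr ⟨(hκ.tendsto z).mono_left nhdsWithin_le_nhds, hne⟩
  refine ⟨s ∘ κ, ?_⟩
  filter_upwards [ht.eventually hs] with y hy
  exact ⟨hy.1.comp hκ.continuousAt, hy.2⟩

theorem not_isEvenAt_mul_sub {c : ℂ} (hc : c ≠ 0) (q : ℂ) :
    ¬ IsEvenAt (fun z => c * (z - q)) q := by
  rw [IsEvenAt.iff_even_of_eq_zpow_mul_exp one_pos (n := 1) (L := fun _ => Complex.log c)
    continuousOn_const fun z _ => by rw [Complex.exp_log hc, zpow_one, mul_comm]]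
  simp

/-- A point which is the only zero, of odd order, of a continuous function equal to `1` near
infinity. -/
def IsOddPoint {S : Type*} [TopologicalSpace S] (q : S) : Prop :=
  ∃ f : S → ℂ, Continuous f ∧ (∀ x, f x = 0 ↔ x = q) ∧ (∃ C, IsCompact C ∧ ∀ x ∉ C, f x = 1) ∧
    ¬ IsEvenAt f q

theorem isOddPoint_of_halfPlane_chart {S : Type*} [TopologicalSpace S] [T2Space S]
    {k : HalfPlane → S} (hk : IsOpenEmbedding k) : IsOddPoint (k ⟨(0, 1), zero_le_one⟩) := by
  set ζ : HalfPlane → ℂ := fun p => ⟨p.1.1, p.1.2⟩ with hζ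
  have hζe : IsClosedEmbedding ζ :=
    Complex.equivRealProdCLM.symm.toHomeomorph.isClosedEmbedding.comp
      (isClosed_le continuous_const continuous_snd).isClosedEmbedding_subtypeVal
  have hζc := hζe.continuous
  set χ : HalfPlane → ℝ := fun p => max 0 (min 1 (3 - ‖ζ p‖)) with hχ
  have hχ1 : ∀ p, ‖ζ p‖ ≤ 2 → χ p = 1 := by
    intro p hp
    simp only [hχ]
    rw [min_eq_left (by linarith)]
    simp
  have hχ0 : ∀ p, 3 < ‖ζ p‖ → χ p = 0 := fun p hp =>
    max_eq_left ((min_le_right _ _).trans (by linarith))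
  have hχnn : ∀ p, 0 ≤ χ p := fun p => le_max_left _ _
  set v : HalfPlane → ℂ := fun p =>
    χ p * (-Complex.I * (ζ p - Complex.I)) + (1 - χ p) with hv
  have hvc : Continuous v := by fun_prop
  have hre : ∀ p, (v p).re = χ p * (p.1.2 - 1) + (1 - χ p) := fun p => by
    simp [hv, hζ]
    ring
  have him : ∀ p, (v p).im = -(χ p * p.1.1) := fun p => by simp [hv, hζ]
  have hv0 : ∀ p, v p = 0 ↔ p = ⟨(0, 1), zero_le_one⟩ := by
    intro p
    constructor
    · intro h
      have h1 := hre p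
      have h2 := him p
      rw [h] at h1 h2
      simp only [Complex.zero_re, Complex.zero_im] at h1 h2
      have hx : p.1.1 = 0 := by
        rcases mul_eq_zero.mp (neg_eq_zero.mp h2.symm) with h3 | h3
        · rw [h3] at h1; norm_num at h1
        · exact h3
      have hy : p.1.2 = 1 := by
        by_cases hy2 : p.1.2 ≤ 2
        · have : ‖ζ p‖ ≤ 2 := by
            have : ζ p = (p.1.2 : ℝ) * Complex.I := by
              apply Complex.ext <;> simp [hζ, hx]
            rw [this, norm_mul, Complex.norm_I, Complex.norm_real, mul_one,
              Real.norm_of_nonneg p.2]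
            exact hy2
          rw [hχ1 p this] at h1
          linarith
        · nlinarith [hχnn p]
      exact Subtype.ext (Prod.ext hx hy)
    · rintro rfl
      have : χ ⟨(0, 1), zero_le_one⟩ = 1 := by
        refine hχ1 _ ?_
        have : ζ ⟨(0, 1), zero_le_one⟩ = Complex.I := by
          apply Complex.ext <;> simp [hζ]
        rw [this]; simp
      apply Complex.ext
      · simp [hre, this]
      · simp [him]
  have hC : IsCompact (ζ ⁻¹' Metric.closedBall 0 3) :=
    hζe.isCompact_preimage (isCompact_closedBall _ _)
  obtain ⟨f, hf, hfk, hf1⟩ := exists_extension_of_eqOn_compl hk hvc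
    (continuous_const (y := (1 : ℂ))) hC fun p hp => by
      have : χ p = 0 := hχ0 p (by simpa using hp)
      simp [hv, this]
  refine ⟨f, hf, fun x => ?_, ⟨_, hC.image hk.continuous, hf1⟩, fun hev => ?_⟩
  · by_cases hx : x ∈ k '' (ζ ⁻¹' Metric.closedBall 0 3)
    · obtain ⟨p, -, rfl⟩ := hx
      rw [hfk, hv0, hk.injective.eq_iff]
    · have hx1 := hf1 x hx
      simp only [hx1, one_ne_zero, false_iff]
      rintro rfl
      rw [hfk, (hv0 _).mpr rfl] at hx1
      exact zero_ne_one hx1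
  · set κ : ℂ → HalfPlane := fun z => ⟨(z.re, max 0 z.im), le_max_left _ _⟩ with hκ
    have hκc : Continuous κ := by
      refine Continuous.subtype_mk ?_ _
      have := Complex.continuous_re
      have := Complex.continuous_im
      fun_prop
    have hball : ∀ᶠ z in 𝓝 Complex.I, ζ (κ z) = z ∧ ‖z‖ ≤ 2 := by
      filter_upwards [Metric.ball_mem_nhds Complex.I one_pos] with z hz
      have h1 : ‖z - Complex.I‖ < 1 := by simpa [dist_eq_norm] using hz
      have h2 := (Complex.abs_im_le_norm (z - Complex.I)).trans_lt h1
      rw [abs_lt] at h2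
      simp only [Complex.sub_im, Complex.I_im] at h2
      refine ⟨Complex.ext rfl (max_eq_right (by linarith)), ?_⟩
      have h3 := norm_add_le (z - Complex.I) Complex.I
      rw [sub_add_cancel, Complex.norm_I] at h3
      linarith
    have hκI : κ Complex.I = ⟨(0, 1), zero_le_one⟩ := by
      apply Subtype.ext
      simp [hκ]
    refine not_isEvenAt_mul_sub (neg_ne_zero.mpr Complex.I_ne_zero) Complex.I
      (IsEvenAt.congr (IsEvenAt.comp (u := f) (hk.continuous.comp hκc) (z := Complex.I) ?_ ?_) ?_)
    · rw [eventually_nhdsWithin_iff]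
      filter_upwards [hball] with z hz hzI h
      have := hk.injective h
      rw [← hball.self_of_nhds.1, ← this, hz.1] at hzI
      exact hzI rfl
    · rwa [Function.comp_apply, hκI]
    · refine nhdsWithin_le_nhds ?_
      filter_upwards [hball] with z hz
      simp only [Function.comp_apply, hfk, hv]
      rw [hχ1 _ (hz.1.symm ▸ hz.2), hz.1]
      simp

theorem IsOddPoint.of_plane_chart {S : Type*} [TopologicalSpace S] [T2Space S] {j : ℂ → S}
    (hj : IsOpenEmbedding j) {p p' : ℂ} (hp : IsOddPoint (j p)) : IsOddPoint (j p') := by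
  obtain ⟨f, hf, hf0, ⟨C, hC, hfC⟩, hodd⟩ := hp
  set ρ : ℝ := ‖p - p'‖ + 1 with hρ
  have hρ0 : 0 < ρ := by positivity
  set χ : ℂ → ℝ := fun z => max 0 (min 1 (2 - ‖z - p'‖ / ρ)) with hχ
  have hχc : Continuous χ := by fun_prop
  have hχ1 : ∀ z, ‖z - p'‖ ≤ ρ → χ z = 1 := by
    intro z hz
    have : ‖z - p'‖ / ρ ≤ 1 := (div_le_one hρ0).mpr hz
    simp only [hχ]
    rw [min_eq_left (by linarith)]
    simp
  have hχ0 : ∀ z, 2 * ρ < ‖z - p'‖ → χ z = 0 := by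
    intro z hz
    have : 2 < ‖z - p'‖ / ρ := (lt_div_iff₀ hρ0).mpr hz
    exact max_eq_left ((min_le_right _ _).trans (by linarith))
  have hχI : ∀ z, 0 ≤ χ z ∧ χ z ≤ 1 := fun z =>
    ⟨le_max_left _ _, max_le zero_le_one (min_le_left _ _)⟩
  set h : ℂ → ℂ := fun z => z + χ z * (p - p') with hh
  have hhc : Continuous h := by fun_prop
  have hhp : ∀ z, h z = p ↔ z = p' := by
    intro z
    constructor
    · intro hz
      have h1 : z - p' = (1 - χ z : ℝ) * (p - p') := by
        simp only [hh] at hz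
        push_cast
        linear_combination hz
      have h2 : ‖z - p'‖ ≤ ρ := by
        rw [h1, norm_mul, Complex.norm_real, Real.norm_of_nonneg (by linarith [(hχI z).2])]
        nlinarith [(hχI z).1, (hχI z).2, norm_nonneg (p - p')]
      rw [hχ1 z h2] at h1
      simpa [sub_eq_zero] using h1
    · rintro rfl
      simp [hh, hχ1 z (by simp [hρ0.le])]
  obtain ⟨w, hw, hwj, hwf⟩ := exists_extension_of_eqOn_compl hj (v := fun z => f (j (h z)))
    (hf.comp (hj.continuous.comp hhc)) hf (isCompact_closedBall p' (2 * ρ)) fun z hz => by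
      have : χ z = 0 := hχ0 z (by simpa [dist_eq_norm] using hz)
      simp [hh, this]
  refine ⟨w, hw, fun x => ?_, ⟨C ∪ j '' Metric.closedBall p' (2 * ρ), hC.union
    ((isCompact_closedBall _ _).image hj.continuous), fun x hx => ?_⟩, fun hev => hodd ?_⟩
  · by_cases hx : x ∈ j '' Metric.closedBall p' (2 * ρ)
    · obtain ⟨z, -, rfl⟩ := hx
      rw [hwj, hf0, hj.injective.eq_iff, hhp, hj.injective.eq_iff]
    · rw [hwf x hx, hf0]
      have hmem : ∀ y, ‖y - p'‖ ≤ ρ → x ≠ j y := by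
        rintro y hy rfl
        exact hx ⟨y, by simp [dist_eq_norm]; linarith, rfl⟩
      exact iff_of_false (hmem p (by simp [hρ])) (hmem p' (by simp [hρ0.le]))
  · rw [hwf x fun h => hx (Or.inr h), hfC x fun h => hx (Or.inl h)]
  · rw [← IsEvenAt.comp_isOpenEmbedding_iff hj] at hev ⊢
    have h1 : IsEvenAt ((f ∘ j) ∘ Homeomorph.addRight (p - p')) p' := by
      refine hev.congr (nhdsWithin_le_nhds ?_)
      filter_upwards [Metric.ball_mem_nhds p' hρ0] with z hz
      have : χ z = 1 := hχ1 z (le_of_lt (by simpa [dist_eq_norm] using hz))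
      simp [hwj, hh, this]
    rw [IsEvenAt.comp_isOpenEmbedding_iff (Homeomorph.addRight (p - p')).isOpenEmbedding] at h1
    simpa using h1

theorem exists_isOpenEmbedding_halfPlane :
    ∃ m : ℂ → HalfPlane, IsOpenEmbedding m ∧ range m = {p | 0 < p.1.2} := by
  have hm : IsOpenEmbedding fun z : ℂ => Prod.map id Real.exp (z.re, z.im) :=
    (IsOpenEmbedding.id.prodMap Real.isOpenEmbedding_exp).comp isOpenEmbedding_equivRealProd
  refine ⟨fun z => ⟨Prod.map id Real.exp (z.re, z.im), (Real.exp_pos _).le⟩, ?_, ?_⟩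
  · refine isOpenEmbedding_of_isEmbedding_val hm.isEmbedding hm.isOpen_range fun t => ?_
    simp only [Subtype.ext_iff, mem_range]
  · ext p
    constructor
    · rintro ⟨z, rfl⟩
      exact Real.exp_pos _
    · intro hp
      refine ⟨⟨p.1.1, Real.log p.1.2⟩, Subtype.ext ?_⟩
      exact Prod.ext rfl (Real.exp_log hp)

theorem dense_interior_halfPlane : Dense {p : HalfPlane | 0 < p.1.2} := by
  intro p
  have hc : Continuous fun t : ℝ => (⟨(p.1.1, p.1.2 + |t|), add_nonneg p.2 (abs_nonneg t)⟩ :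
      HalfPlane) := by fun_prop
  have h1 : Filter.Tendsto (fun t : ℝ => (⟨(p.1.1, p.1.2 + |t|), add_nonneg p.2 (abs_nonneg t)⟩ :
      HalfPlane)) (𝓝[≠] 0) (𝓝 p) := by
    have := hc.tendsto 0
    simp only [abs_zero, add_zero] at this
    exact this.mono_left nhdsWithin_le_nhds
  refine mem_closure_of_tendsto h1 ?_
  filter_upwards [self_mem_nhdsWithin] with t ht
  have := abs_pos.mpr ht
  have := p.2
  change 0 < p.1.2 + |t|
  linarith

/-- Near each point of a surface, the interior points are all odd or all not odd. -/
theorem IsSurface.eventually_isOddPoint_or {S : Type*} [TopologicalSpace S] (hS : IsSurface S)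
    (x : S) :
    (∀ᶠ y in 𝓝 x, y ∉ Bd S → IsOddPoint y) ∨ ∀ᶠ y in 𝓝 x, y ∉ Bd S → ¬ IsOddPoint y := by
  have := hS.t2
  rcases hS.exists_chart x with ⟨j, hj, ⟨z, rfl⟩⟩ | ⟨k, hk, rfl⟩
  · by_cases hz : IsOddPoint (j z)
    · left
      filter_upwards [hj.isOpen_range.mem_nhds ⟨z, rfl⟩] with y hy _
      obtain ⟨y, rfl⟩ := hy
      exact hz.of_plane_chart hj
    · right
      filter_upwards [hj.isOpen_range.mem_nhds ⟨z, rfl⟩] with y hy _ hodd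
      obtain ⟨y, rfl⟩ := hy
      exact hz (hodd.of_plane_chart hj)
  · left
    obtain ⟨m, hm, hmr⟩ := exists_isOpenEmbedding_halfPlane
    have hkm := hk.comp hm
    have hodd : ∀ z, IsOddPoint (k (m z)) := by
      obtain ⟨z0, hz0⟩ : (⟨(0, 1), zero_le_one⟩ : HalfPlane) ∈ range m := by
        rw [hmr]; exact (one_pos : (0 : ℝ) < 1)
      intro z
      refine IsOddPoint.of_plane_chart hkm (p := z0) ?_
      rw [Function.comp_apply, hz0]
      exact isOddPoint_of_halfPlane_chart hk
    filter_upwards [hk.isOpen_range.mem_nhds ⟨_, rfl⟩] with y hy hyB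
    obtain ⟨p, rfl⟩ := hy
    obtain ⟨j, hj, ⟨z, hz⟩⟩ := notMem_Bd_iff.mp hyB
    have hopen : IsOpen (k ⁻¹' range j) := hj.isOpen_range.preimage hk.continuous
    obtain ⟨p', hp'j, hp'⟩ := dense_interior_halfPlane.inter_open_nonempty _ hopen ⟨p, z, hz⟩
    obtain ⟨w, hw⟩ := hp'j
    have hp'm : p' ∈ range m := by rw [hmr]; exact hp'
    obtain ⟨z', rfl⟩ := hp'm
    rw [← hz]
    refine IsOddPoint.of_plane_chart hj (p := w) ?_
    rw [hw]
    exact hodd z'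

theorem IsSurface.dense_compl_Bd {S : Type*} [TopologicalSpace S] (hS : IsSurface S) :
    Dense (Bd S)ᶜ := by
  intro x
  rcases hS.exists_chart x with h | ⟨k, hk, rfl⟩
  · exact subset_closure (notMem_Bd_iff.mpr h)
  · obtain ⟨m, hm, hmr⟩ := exists_isOpenEmbedding_halfPlane
    refine closure_mono ?_ (image_closure_subset_closure_image hk.continuous
      ⟨_, dense_interior_halfPlane _, rfl⟩)
    rintro _ ⟨p, hp, rfl⟩
    rw [← hmr] at hp
    obtain ⟨z, rfl⟩ := hp
    exact notMem_Bd_iff.mpr ⟨_, hk.comp hm, z, rfl⟩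

/-- Interior points of a surface with boundary are odd. -/
theorem IsSurface.isOddPoint {S : Type*} [TopologicalSpace S] (hS : IsSurface S)
    (hB : (Bd S).Nonempty) {q : S} (hq : q ∉ Bd S) : IsOddPoint q := by
  have := hS.t2
  have := hS.connected
  set A : Set S := {x | ∀ᶠ y in 𝓝 x, y ∉ Bd S → IsOddPoint y} with hA
  set B : Set S := {x | ∀ᶠ y in 𝓝 x, y ∉ Bd S → ¬ IsOddPoint y} with hBdef
  have hAo : IsOpen A := isOpen_iff_mem_nhds.mpr fun x hx => eventually_eventually_nhds.mpr hx
  have hBo : IsOpen B := isOpen_iff_mem_nhds.mpr fun x hx => eventually_eventually_nhds.mpr hx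
  have hdisj : A ∩ B = ∅ := by
    refine eq_empty_iff_forall_notMem.mpr fun x hx => ?_
    obtain ⟨y, hy, hyB⟩ := mem_closure_iff_nhds.mp (hS.dense_compl_Bd x) _
      (Filter.inter_mem hx.1 hx.2)
    exact hy.2 hyB (hy.1 hyB)
  obtain ⟨b, hb⟩ := hB
  have hq' : q ∈ A ∪ B := hS.eventually_isOddPoint_or q
  rcases hq' with hqA | hqB
  · exact Filter.Eventually.self_of_nhds hqA hq
  exfalso
  obtain ⟨k, hk⟩ : ∃ k : HalfPlane → S, IsOpenEmbedding k := by
    rcases hS.exists_chart b with h | ⟨k, hk, -⟩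
    · exact absurd hb (notMem_Bd_iff.mpr h)
    · exact ⟨k, hk⟩
  obtain ⟨m, hm, hmr⟩ := exists_isOpenEmbedding_halfPlane
  have hpB : k ⟨(0, 1), zero_le_one⟩ ∉ Bd S := by
    refine notMem_Bd_iff.mpr ⟨_, hk.comp hm, ?_⟩
    obtain ⟨z, hz⟩ : (⟨(0, 1), zero_le_one⟩ : HalfPlane) ∈ range m := by
      rw [hmr]; exact (one_pos : (0 : ℝ) < 1)
    exact ⟨z, congrArg k hz⟩
  have hpA : k ⟨(0, 1), zero_le_one⟩ ∈ A := by
    refine (hS.eventually_isOddPoint_or _).resolve_right fun h => ?_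
    exact Filter.Eventually.self_of_nhds h hpB (isOddPoint_of_halfPlane_chart hk)
  obtain ⟨x, -, hx⟩ := isPreconnected_univ A B hAo hBo (fun x _ => hS.eventually_isOddPoint_or x)
    ⟨_, trivial, hpA⟩ ⟨q, trivial, hqB⟩
  rw [hdisj] at hx
  exact hx

/-- A continuous nonvanishing complex function on a closed subset of the unit interval extends to a
continuous nonvanishing function. -/
theorem exists_extension_ne_zero {K : Set I} (hK : IsClosed K) {k : I → ℂ} (hk : ContinuousOn k K)
    (hk0 : ∀ t ∈ K, k t ≠ 0) : ∃ g : I → ℂ, Continuous g ∧ (∀ t, g t ≠ 0) ∧ EqOn g k K := by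
  obtain ⟨F, hF⟩ := ContinuousMap.exists_restrict_eq hK ⟨K.domRestrict k, hk.domRestrict⟩
  have hFk : EqOn F k K := fun t ht => congrArg (fun f : C(K, ℂ) => f ⟨t, ht⟩) hF
  obtain ⟨δ, hδ, hFδ⟩ : ∃ δ > 0, ∀ t ∈ K, δ ≤ ‖F t‖ := by
    rcases K.eq_empty_or_nonempty with h | h
    · exact ⟨1, one_pos, by simp [h]⟩
    · obtain ⟨t, ht, hmin⟩ := hK.isCompact.exists_isMinOn h F.continuous.norm.continuousOn
      exact ⟨‖F t‖, norm_pos_iff.mpr (hFk ht ▸ hk0 t ht), fun y hy => hmin hy⟩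
  obtain ⟨G, hG, hGF, -⟩ := (F.continuous.Icc_extend' (h := zero_le_one)).exists_contDiff_approx
    (ε := fun _ => δ / 4) 1 continuous_const fun _ => by positivity
  obtain ⟨c, hc, hcδ⟩ := (ContDiff.dense_compl_range_of_finrank_lt_finrank (mod_cast hG)
    (by simp)).inter_open_nonempty _ Metric.isOpen_ball
    ⟨(0 : ℂ), Metric.mem_ball_self (show 0 < δ / 4 by positivity)⟩
  have hGt : ∀ t : I, ‖G t - c - F t‖ < δ / 2 := fun t => by
    have h1 := hGF t
    rw [IccExtend_val, dist_eq_norm] at h1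
    have h2 : ‖c‖ < δ / 4 := by simpa using hc
    calc ‖G t - c - F t‖ = ‖(G t - F t) - c‖ := by ring_nf
      _ ≤ ‖G t - F t‖ + ‖c‖ := norm_sub_le _ _
      _ < δ / 2 := by linarith
  set μ : I → ℝ := fun t => max 0 (min 1 (2 - 2 / δ * ‖F t‖)) with hμ
  have hGc := hG.continuous
  refine ⟨fun t => F t + μ t * (G t - c - F t), by fun_prop, fun t h0 => ?_, fun t ht => ?_⟩
  · by_cases ht : ‖F t‖ ≤ δ / 2
    · have h1 : μ t = 1 := by
        have : 2 / δ * ‖F t‖ ≤ 1 := by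
          rw [div_mul_eq_mul_div, div_le_one hδ]; linarith
        rw [hμ]
        simp only
        rw [min_eq_left (by linarith), max_eq_right zero_le_one]
      simp only [h1] at h0
      exact hcδ ⟨t, by push_cast at h0; linear_combination h0⟩
    · have h1 : 0 ≤ μ t := le_max_left _ _
      have h2 : μ t ≤ 1 := max_le zero_le_one (min_le_left _ _)
      have h3 : F t = -(μ t * (G t - c - F t)) := by linear_combination h0
      have h4 := congrArg norm h3
      rw [norm_neg, norm_mul, Complex.norm_real, Real.norm_of_nonneg h1] at h4
      nlinarith [hGt t, norm_nonneg (G t - c - F t)]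
  · have h1 : μ t = 0 := by
      refine max_eq_left ((min_le_right _ _).trans ?_)
      have : 2 ≤ 2 / δ * ‖F t‖ := by
        rw [div_mul_eq_mul_div, le_div_iff₀ hδ]; linarith [hFδ t ht]
      linarith
    simp [h1, hFk ht]

theorem mem_edgeInt_or (t : I) : t ∈ edgeInt ∨ t = 0 ∨ t = 1 := by
  rcases t.2.1.eq_or_lt with h | h
  · exact Or.inr (Or.inl (Subtype.ext h.symm))
  · rcases t.2.2.eq_or_lt with h' | h'
    · exact Or.inr (Or.inr (Subtype.ext h'))
    · exact Or.inl ⟨h, h'⟩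

/-- On a graph, a continuous complex function that vanishes nowhere on a compact set agrees there
with one that vanishes nowhere and equals `1` off a compact set. -/
theorem IsGraph.exists_ne_zero {Γ : Type*} [TopologicalSpace Γ] (hΓ : IsGraph Γ) {a : Γ → ℂ}
    (ha : Continuous a) {C : Set Γ} (hC : IsCompact C) (ha0 : ∀ x ∈ C, a x ≠ 0) :
    ∃ g : Γ → ℂ, Continuous g ∧ (∀ x, g x ≠ 0) ∧ EqOn g a C ∧
      ∃ L, IsCompact L ∧ ∀ x ∉ L, g x = 1 := by
  classical
  have := hΓ.t2
  obtain ⟨V, E, -, -, hEV, hemb, hdV, hdE, hcov, hfin, hweak, hiso⟩ := hΓ.cell_structure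
  have hcase : ∀ x, x ∈ V ∨ ∃ e ∈ E, ∃ t ∈ edgeInt, e t = x := fun x => by
    have : x ∈ V ∪ ⋃ e ∈ E, ⇑e '' edgeInt := hcov ▸ trivial
    simpa using this
  have : WeaklyLocallyCompactSpace Γ := by
    refine ⟨fun x => ?_⟩
    obtain ⟨U, hU, hxU, hUfin⟩ := hfin x
    refine ⟨(⋃ e ∈ {e ∈ E | (range ⇑e ∩ U).Nonempty}, range ⇑e) ∪ {x}, ?_,
      Filter.mem_of_superset (hU.mem_nhds hxU) fun y hy => ?_⟩
    · exact (hUfin.isCompact_biUnion fun e _ => isCompact_range e.continuous).union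
        isCompact_singleton
    · by_cases h : ∃ e ∈ E, y ∈ range ⇑e
      · obtain ⟨e, he, hye⟩ := h
        exact Or.inl (mem_biUnion (x := e) ⟨he, y, hye, hy⟩ hye)
      · right
        rcases hcase y with hyV | ⟨e, he, t, -, rfl⟩
        · have h1 := (hiso y hyV).resolve_left h
          have h2 : x ∈ (univ : Set Γ) := trivial
          rw [h1] at h2
          exact h2.symm
        · exact absurd ⟨e, he, t, rfl⟩ h
  obtain ⟨L, hL, hCL⟩ := exists_compact_superset hC
  set k : Γ → ℂ := fun x => if x ∈ C then a x else 1 with hk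
  have hk0 : ∀ x, k x ≠ 0 := fun x => by
    by_cases hx : x ∈ C
    · simpa [hk, hx] using ha0 x hx
    · simp [hk, hx]
  have hkC : EqOn k a C := fun x hx => if_pos hx
  have hkL : ∀ x ∉ L, k x = 1 := fun x hx => if_neg fun h => hx (interior_subset (hCL h))
  by_cases hsub : ∃ v, (univ : Set Γ) = {v}
  · obtain ⟨v, hv⟩ := hsub
    have : Subsingleton Γ := subsingleton_of_univ_subsingleton (hv ▸ subsingleton_singleton)
    exact ⟨k, continuous_of_const fun x y => by rw [Subsingleton.elim x y], hk0, hkC, L, hL, hkL⟩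
  have hedge : ∀ e : C(I, Γ), ∃ g : I → ℂ, Continuous g ∧ (∀ t, g t ≠ 0) ∧
      ∀ t, e t ∈ C ∨ e t ∉ L ∨ t = 0 ∨ t = 1 → g t = k (e t) := by
    intro e
    have hP : IsClosed (e ⁻¹' C) := hC.isClosed.preimage e.continuous
    have hQ : IsClosed ((e ⁻¹' (interior L)ᶜ) ∪ ({0, 1} \ e ⁻¹' C)) :=
      (isOpen_interior.isClosed_compl.preimage e.continuous).union
        ((toFinite _).isClosed)
    have hQC : ∀ t ∈ (e ⁻¹' (interior L)ᶜ) ∪ ({0, 1} \ e ⁻¹' C), e t ∉ C := by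
      rintro t (h | h) htC
      · exact h (hCL htC)
      · exact h.2 htC
    have hc : ContinuousOn (k ∘ e) (e ⁻¹' C ∪ ((e ⁻¹' (interior L)ᶜ) ∪ ({0, 1} \ e ⁻¹' C))) := by
      refine ContinuousOn.union_of_isClosed ?_ ?_ hP hQ
      · exact (ha.comp e.continuous).continuousOn.congr fun t ht => hkC ht
      · exact (continuousOn_const (c := (1 : ℂ))).congr fun t ht => if_neg (hQC t ht)
    obtain ⟨g, hg, hg0, hgk⟩ := exists_extension_ne_zero (hP.union hQ) hc fun t _ => hk0 _
    refine ⟨g, hg, hg0, fun t ht => hgk ?_⟩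
    by_cases h : e t ∈ C
    · exact Or.inl h
    · right
      rcases ht with ht | ht | ht
      · exact absurd ht h
      · exact Or.inl fun h' => ht (interior_subset h')
      · exact Or.inr ⟨ht, h⟩
  choose G hG hG0 hGk using hedge
  have hex : ∀ x, ∃ z : ℂ, z ≠ 0 ∧ (x ∈ V → z = k x) ∧ ∀ e ∈ E, ∀ t, e t = x → z = G e t := by
    have hends : ∀ x ∈ V, ∀ e ∈ E, ∀ t, e t = x → k x = G e t := by
      rintro x hx e he t rfl
      refine (hGk e t (Or.inr (Or.inr ((mem_edgeInt_or t).resolve_left fun ht => ?_)))).symm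
      exact (hdV e he).subset ⟨mem_image_of_mem _ ht, hx⟩
    intro x
    by_cases hx : x ∈ V
    · exact ⟨k x, hk0 x, fun _ => rfl, hends x hx⟩
    · obtain ⟨e, he, t, ht, rfl⟩ := (hcase x).resolve_left hx
      refine ⟨G e t, hG0 e t, fun h => absurd h hx, fun e' he' t' h => ?_⟩
      have ht' : t' ∈ edgeInt := (mem_edgeInt_or t').resolve_right fun h' => hx <| by
        rw [← h]
        rcases h' with rfl | rfl
        exacts [(hEV e' he').1, (hEV e' he').2]
      have hee : e' = e := by
        by_contra hne
        exact (hdE e' he' e he hne).subset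
          ⟨mem_image_of_mem _ ht', h ▸ mem_image_of_mem _ ht⟩
      subst hee
      have := (hemb e' he).injective (a₁ := ⟨t, ht⟩) (a₂ := ⟨t', ht'⟩) h.symm
      rw [Subtype.mk.inj this]
  choose g hg0 hgV hgE using hex
  have hgk : ∀ x, x ∈ C ∨ x ∉ L → g x = k x := fun x hx => by
    rcases hcase x with h | ⟨e, he, t, -, rfl⟩
    · exact hgV x h
    · rw [hgE _ e he t rfl, hGk e t (hx.imp_right Or.inl)]
  refine ⟨g, continuous_iff_isClosed.mpr fun B hB => ?_, hg0,
    fun x hx => (hgk x (Or.inl hx)).trans (hkC hx), L, hL,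
    fun x hx => (hgk x (Or.inr hx)).trans (hkL x hx)⟩
  have hrange : ⋃ e ∈ E, range ⇑e = univ := by
    refine eq_univ_of_forall fun x => ?_
    rcases hcase x with h | ⟨e, he, t, -, rfl⟩
    · obtain ⟨e, he, h'⟩ := (hiso x h).resolve_right fun h' => hsub ⟨x, h'⟩
      exact mem_biUnion he h'
    · exact mem_biUnion he ⟨t, rfl⟩
  rw [← inter_univ (g ⁻¹' B), ← hrange]
  refine hweak _ fun e he => ?_
  have : ⇑e ⁻¹' (g ⁻¹' B) = G e ⁻¹' B := by
    ext t
    simp only [mem_preimage, hgE _ e he t rfl]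
  rw [this]
  exact hB.preimage (hG e)

theorem IsSurface.locallyCompactSpace {S : Type*} [TopologicalSpace S] (hS : IsSurface S) :
    LocallyCompactSpace S := by
  have := hS.t2
  have hH : LocallyCompactSpace HalfPlane :=
    (isClosed_le continuous_const continuous_snd).isClosedEmbedding_subtypeVal.locallyCompactSpace
  have : WeaklyLocallyCompactSpace S := by
    refine ⟨fun x => ?_⟩
    rcases hS.exists_chart x with ⟨j, hj, ⟨z, rfl⟩⟩ | ⟨k, hk, rfl⟩
    · obtain ⟨N, hN, hz⟩ := exists_compact_mem_nhds z
      exact ⟨j '' N, hN.image hj.continuous, hj.isOpenMap.image_mem_nhds hz⟩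
    · obtain ⟨N, hN, hz⟩ := exists_compact_mem_nhds (⟨(0, 0), le_rfl⟩ : HalfPlane)
      exact ⟨k '' N, hN.image hk.continuous, hk.isOpenMap.image_mem_nhds hz⟩
  infer_instance

theorem isCompact_Circ : IsCompact Circ := by
  refine isCompact_Icc.of_isClosed_subset (isClosed_eq (by fun_prop) continuous_const)
    (s := Icc ((-1, -1) : ℝ × ℝ) (1, 1)) fun p hp => ?_
  have hp' : p.1 ^ 2 + p.2 ^ 2 = 1 := hp
  refine ⟨⟨?_, ?_⟩, ⟨?_, ?_⟩⟩ <;> simp only <;> nlinarith [sq_nonneg p.1, sq_nonneg p.2]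

theorem IsSimpleClosedCurve.isCompact {S : Type*} [TopologicalSpace S] {α : Set S}
    (hα : IsSimpleClosedCurve α) : IsCompact α := by
  obtain ⟨f, hf, rfl⟩ := hα
  have := isCompact_iff_compactSpace.mp isCompact_Circ
  exact isCompact_range hf.continuous

theorem isClosed_connectedComponentIn_compl_union {S : Type*} [TopologicalSpace S] {α : Set S}
    (hα : IsClosed α) {x : S} (hx : x ∈ αᶜ) : IsClosed (connectedComponentIn αᶜ x ∪ α) := by
  obtain ⟨D, hD, hDx⟩ := isClosed_induced_iff.mp (isClosed_connectedComponent (x := (⟨x, hx⟩ : ↥αᶜ)))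
  rw [connectedComponentIn_eq_image hx, ← hDx]
  convert hD.union hα using 1
  ext y
  by_cases hy : y ∈ α <;> simp [hy]

/-- A continuous complex function on a compact subset of a locally compact normal space extends to
one that vanishes off a compact set. -/
theorem exists_extension_eq_zero_off_compact {S : Type*} [TopologicalSpace S] [T2Space S]
    [LocallyCompactSpace S] [NormalSpace S] {α : Set S} (hα : IsCompact α) {θ : α → ℂ}
    (hθ : Continuous θ) : ∃ (η : S → ℂ) (L : Set S), Continuous η ∧ IsCompact L ∧
      (∀ x : α, η x = θ x) ∧ ∀ x ∉ L, η x = 0 := by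
  obtain ⟨Θ, hΘ⟩ := ContinuousMap.exists_restrict_eq hα.isClosed ⟨θ, hθ⟩
  obtain ⟨μ, hμ1, -, hμc, -⟩ := exists_continuous_one_zero_of_isCompact hα isClosed_empty
    (disjoint_empty _)
  refine ⟨fun x => μ x * Θ x, tsupport μ, by fun_prop, hμc, fun x => ?_, fun x hx => ?_⟩
  · have h1 : Θ x = θ x := congrArg (fun f : C(α, ℂ) => f x) hΘ
    have h2 : μ x = 1 := hμ1 x.2
    simp [h1, h2]
  · simp [image_eq_zero_of_notMem_tsupport hx]

theorem exists_charts_of_isCompact {S : Type*} [TopologicalSpace S] {K : Set S}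
    (hK : IsCompact K) (hKB : K ∩ Bd S = ∅) :
    ∃ J : List (ℂ → S), (∀ j ∈ J, IsOpenEmbedding j) ∧ K ⊆ ⋃ j ∈ J, range j := by
  obtain ⟨b, hb, hbfin, hKb⟩ := hK.elim_finite_subcover_image
    (b := {j : ℂ → S | IsOpenEmbedding j}) (c := range) (fun j hj => hj.isOpen_range) fun x hx => by
      obtain ⟨j, hj, hxj⟩ := notMem_Bd_iff.mp fun h => hKB.subset ⟨hx, h⟩
      exact mem_biUnion hj hxj
  exact ⟨hbfin.toFinset.toList, fun j hj => hb (by simpa using hj), by simpa using hKb⟩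

/-- A nowhere vanishing function cannot agree with a function having a single, odd zero `q` along
the frontier of a region containing `q` but no boundary points, if both are `1` off a compact
set. -/
theorem false_of_eqOn_frontier {S : Type*} [TopologicalSpace S] [T2Space S] {Y Z α : Set S}
    (hZ : IsClosed (Z ∪ α)) (hY : IsClosed (Y ∪ α)) (hcov : Y ∪ Z ∪ α = univ)
    (hYZ : (Y ∪ α) ∩ (Z ∪ α) ⊆ α) (hZB : (Z ∪ α) ∩ Bd S = ∅) {q : S} (hq : q ∉ Y ∪ α)
    {f r : S → ℂ} (hf : Continuous f) (hr : Continuous r) (hf0 : ∀ x, f x = 0 ↔ x = q)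
    (hr0 : ∀ x, r x ≠ 0) (hfr : ∀ x ∈ α, r x = f x) {C L : Set S} (hC : IsCompact C)
    (hL : IsCompact L) (hfC : ∀ x ∉ C, f x = 1) (hrL : ∀ x ∉ L, r x = 1)
    (hodd : ¬ IsEvenAt f q) : False := by
  classical
  set w : S → ℂ := fun x => star (f x) * if x ∈ Y ∪ α then f x else r x with hw
  have hwY : ∀ x ∈ Y ∪ α, w x = star (f x) * f x := fun x hx => by rw [hw]; simp only [if_pos hx]
  have hwZ : ∀ x ∈ Z ∪ α, w x = star (f x) * r x := fun x hx => by
    by_cases h : x ∈ Y ∪ α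
    · rw [hwY x h, hfr x (hYZ ⟨h, hx⟩)]
    · rw [hw]; simp only [if_neg h]
  have hmem : ∀ x, x ∈ Y ∪ α ∨ x ∈ Z ∪ α := fun x => by
    have : x ∈ Y ∪ Z ∪ α := hcov ▸ trivial
    rcases this with (h | h) | h
    exacts [.inl (.inl h), .inr (.inl h), .inl (.inr h)]
  have hwc : Continuous w := by
    rw [← continuousOn_univ, show (univ : Set S) = (Y ∪ α) ∪ (Z ∪ α) from
      (eq_univ_of_forall hmem).symm]
    refine ContinuousOn.union_of_isClosed ?_ ?_ hY hZ
    · exact (Continuous.continuousOn (by fun_prop)).congr hwY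
    · exact (Continuous.continuousOn (by fun_prop)).congr hwZ
  have hw0 : {x | w x = 0} ⊆ {q} := fun x hx => by
    have hx' : w x = 0 := hx
    rcases hmem x with h | h
    · rw [hwY x h, mul_eq_zero, star_eq_zero, or_self, hf0] at hx'
      exact hx'
    · rw [hwZ x h, mul_eq_zero, star_eq_zero, hf0] at hx'
      exact hx'.resolve_right (hr0 x)
  have hK : IsCompact ((C ∪ L) ∩ (Z ∪ α)) := (hC.union hL).inter_right hZ
  obtain ⟨J, hJ, hKJ⟩ := exists_charts_of_isCompact hK
    (subset_eq_empty (inter_subset_inter_left _ inter_subset_right) hZB)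
  have heven := even_ncard_not_isEvenAt J hJ _ w hK hKJ hwc ((finite_singleton q).subset hw0)
    fun x hx => by
      by_cases h : x ∈ Y ∪ α
      · rw [hwY x h, norm_mul, norm_star, Complex.star_def, Complex.conj_mul', sq]
        push_cast
        rfl
      · have hxZ := (hmem x).resolve_left h
        have hxCL : x ∉ C ∪ L := fun h' => hx ⟨h', hxZ⟩
        rw [hwZ x hxZ, hfC x fun h' => hxCL (.inl h'), hrL x fun h' => hxCL (.inr h')]
        simp
  have hwq : ¬ IsEvenAt w q := fun h => hodd <| by
    have h1 : IsEvenAt (fun x => star (f x) * r x) q := h.congr <| by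
      refine nhdsWithin_le_nhds ?_
      filter_upwards [hY.isOpen_compl.mem_nhds hq] with x hx
      exact hwZ x ((hmem x).resolve_left hx)
    rwa [IsEvenAt.mul_iff_right hr (hr0 q), IsEvenAt.conj_iff] at h1
  have hset : {x | ¬ IsEvenAt w x} = {q} := by
    refine Subset.antisymm (fun x hx => hw0 ?_) (singleton_subset_iff.mpr hwq)
    by_contra h0
    exact hx (.of_ne_zero hwc h0)
  rw [hset, ncard_singleton] at heven
  exact absurd heven (by decide)

/-- If a surface `S` has a boundary isolating curve, then `S` is not
properly homotopy equivalent to any graph. -/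
theorem not_PHE_graph_of_boundaryIsolating (S : Type*) [TopologicalSpace S]
    (hS : IsSurface S) (h : ∃ α : Set S, IsBoundaryIsolating α)
    (Γ : Type*) [TopologicalSpace Γ] (hΓ : IsGraph Γ) :
    ¬ PHEquivalent S Γ := by
  rintro ⟨φ, ψ, ⟨hφ, hφp⟩, ⟨hψ, -⟩, ⟨H, ⟨hH, -⟩, hH0, hH1⟩, -⟩
  obtain ⟨α, hαc, hαB, Y, Z, hne, hcomp, hYB, hZB, hZnc⟩ := h
  have := hS.t2
  have := hS.secondCountable
  have := hS.locallyCompactSpace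
  have hα : IsCompact α := hαc.isCompact
  obtain ⟨y, hy, rfl⟩ := (hcomp Y).mpr (Or.inl rfl)
  obtain ⟨z, hz, rfl⟩ := (hcomp Z).mpr (Or.inr rfl)
  set Y := connectedComponentIn αᶜ y
  set Z := connectedComponentIn αᶜ z
  have hYcl : IsClosed (Y ∪ α) := isClosed_connectedComponentIn_compl_union hα.isClosed hy
  have hZcl : IsClosed (Z ∪ α) := isClosed_connectedComponentIn_compl_union hα.isClosed hz
  have hYZ : ∀ x, x ∈ Y → x ∉ Z := fun x hxY hxZ =>
    hne ((connectedComponentIn_eq hxY).trans (connectedComponentIn_eq hxZ).symm)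
  have hcov : Y ∪ Z ∪ α = univ := eq_univ_of_forall fun x => by
    by_cases hx : x ∈ α
    · exact Or.inr hx
    · have hxx := mem_connectedComponentIn (F := αᶜ) hx
      left
      rcases (hcomp _).mp ⟨x, hx, rfl⟩ with h | h
      · exact Or.inl (h ▸ hxx)
      · exact Or.inr (h ▸ hxx)
  set T : Set S := H '' (α ×ˢ univ) with hT
  have hTc : IsCompact T := (hα.prod isCompact_univ).image hH
  obtain ⟨q, hqZ, hqT⟩ : ∃ q ∈ Z ∪ α, q ∉ T := by
    by_contra! hsub
    exact hZnc (hTc.of_isClosed_subset hZcl hsub)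
  have hqα : q ∉ α := fun h => hqT ⟨(q, 1), ⟨h, trivial⟩, hH1 q⟩
  replace hqZ := hqZ.resolve_right hqα
  obtain ⟨f, hf, hf0, ⟨C, hC, hfC⟩, hodd⟩ := hS.isOddPoint (hYB.mono inter_subset_right)
    (q := q) fun h => hZB.subset ⟨hqZ, h⟩
  have hfH : ∀ x ∈ α, ∀ t, f (H (x, t)) ≠ 0 := fun x hx t h =>
    hqT ((hf0 _).mp h ▸ ⟨(x, t), ⟨hx, trivial⟩, rfl⟩)
  obtain ⟨g, hg, hg0, hga, L, hL, hgL⟩ := hΓ.exists_ne_zero (hf.comp hψ) (hα.image hφ) <| by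
    rintro _ ⟨x, hx, rfl⟩ h
    exact hfH x hx 0 (by rwa [hH0])
  obtain ⟨θ, hθ, hθe⟩ := exists_exp_eq_of_homotopy
    (H := fun p : I × α => f (H (p.2, p.1))) (by fun_prop) fun p => hfH _ p.2.2 _
  obtain ⟨η, M, hη, hM, hηα, hηM⟩ := exists_extension_eq_zero_off_compact hα hθ
  refine false_of_eqOn_frontier (r := fun x => g (φ x) * Complex.exp (η x)) hZcl hYcl hcov
    ?_ ?_ (fun h => h.elim (fun h => hYZ q h hqZ) hqα) hf (by fun_prop) hf0
    (fun x => mul_ne_zero (hg0 _) (Complex.exp_ne_zero _)) ?_ hC ((hφp L hL).union hM) hfC ?_ hodd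
  · rintro x ⟨hx1 | hx1, hx2 | hx2⟩
    exacts [absurd hx2 (hYZ x hx1), hx2, hx1, hx1]
  · rw [union_inter_distrib_right, hZB, hαB, union_empty]
  · intro x hx
    have h1 := hθe ⟨x, hx⟩
    simp only [hH0, hH1] at h1
    rw [hga ⟨x, hx, rfl⟩, hηα ⟨x, hx⟩]
    exact h1.symm
  · intro x hx
    have h1 : φ x ∉ L := fun h => hx (Or.inl h)
    have h2 : x ∉ M := fun h => hx (Or.inr h)
    simp [hgL _ h1, hηM _ h2]
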